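/- Musta\c{t}\u{a}–Schenck theorem for multiarrangements: Let (A,m) be a multiarrangement on an essential arrangement A in K^ℓ which is locally free, i.e., (A_X, m_X) is free for all 0 ≠ X ∈ L(A). If pd_S Ω^1(A,m) = 1, then ⋀^p Ω^1(A,m) = Ω^p(A,m) and pd_S Ω^p(A,m) = p for all 0 ≤ p ≤ ℓ−2; in particular (A,m) is tame. -/

import Mathlib

noncomputable section
open Classical MvPolynomial

/-- `pdLE R n M` : the `R`-module `M` has projective dimension at most `n`. -/
def pdLE (R : Type) [CommRing R] : ℕ → (M : Type) → [AddCommGroup M] → [Module R M] → Prop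
  | 0, M, _, _ => Module.Projective R M
  | n + 1, M, _, _ => ∃ (ι : Type) (f : (ι →₀ R) →ₗ[R] M),
      Function.Surjective f ∧ pdLE R n (LinearMap.ker f)

/-- Projective dimension as an element of `ℕ∞`. -/
def pdim (R : Type) [CommRing R] (M : Type) [AddCommGroup M] [Module R M] : ℕ∞ :=
  sInf {n : ℕ∞ | ∃ k : ℕ, pdLE R k M ∧ n = (k : ℕ∞)}

/-- The coordinate ring `S = K[x_1, …, x_ℓ]`. -/
abbrev PS (K : Type) [Field K] (ℓ : ℕ) : Type := MvPolynomial (Fin ℓ) K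

/-- The free `S`-module of polynomial differential forms of all degrees, realized as the
exterior algebra over `S` on the free module `S^ℓ` (with `dx_i` the standard basis). -/
abbrev ExtF (K : Type) [Field K] (ℓ : ℕ) : Type :=
  ExteriorAlgebra (PS K ℓ) (Fin ℓ → PS K ℓ)

variable {K : Type} [Field K] {ℓ : ℕ}

/-- The module `Ω^p_V` of polynomial differential `p`-forms. -/
def formsP (K : Type) [Field K] (ℓ : ℕ) (p : ℕ) : Submodule (PS K ℓ) (ExtF K ℓ) :=
  (LinearMap.range (ExteriorAlgebra.ι (PS K ℓ) :
      (Fin ℓ → PS K ℓ) →ₗ[PS K ℓ] ExtF K ℓ)) ^ p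

/-- The defining linear form `α = ∑ c_i x_i` of the hyperplane with coefficient vector `c`. -/
def linP (c : Fin ℓ → K) : PS K ℓ := ∑ i, MvPolynomial.C (c i) * MvPolynomial.X i

/-- The constant one-form `dα = ∑ c_i dx_i`. -/
def dP (c : Fin ℓ → K) : ExtF K ℓ :=
  ExteriorAlgebra.ι (PS K ℓ) (fun i => MvPolynomial.C (c i))

/-- A central hyperplane arrangement in `K^ℓ`: a finite set of (pairwise non-proportional,
nonzero) coefficient vectors of defining linear forms, each representing the hyperplane
`{x : ∑ c_i x_i = 0}`. -/
structure Arrangement (K : Type) [Field K] (ℓ : ℕ) : Type where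
  hyps : Finset (Fin ℓ → K)
  ne_zero : ∀ c ∈ hyps, c ≠ 0
  nonprop : ∀ c ∈ hyps, ∀ c' ∈ hyps, c ≠ c' → ∀ t : K, c ≠ t • c'

/-- The polynomial model of the module `Ω^p(A,m)` of logarithmic `p`-forms of the
multiarrangement `(A,m)`; it is `Q(A,m)·Ω^p(A,m)`, i.e. the image of `Ω^p(A,m)` under the
degree-shifting isomorphism given by multiplication with `Q(A,m)`, so that
`η = Q(A,m)·ω` ranges over polynomial `p`-forms with `dα_H ∧ η ∈ α_H^{m(H)} Ω^{p+1}_V`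
for all `H ∈ A`. -/
def Omega (A : Arrangement K ℓ) (m : (Fin ℓ → K) → ℕ) (p : ℕ) :
    Submodule (PS K ℓ) (ExtF K ℓ) :=
  formsP K ℓ p ⊓ ⨅ c ∈ A.hyps,
    Submodule.comap (LinearMap.mulLeft (PS K ℓ) (dP c))
      (Submodule.map (LinearMap.lsmul (PS K ℓ) (ExtF K ℓ) (linP c ^ m c))
        (formsP K ℓ (p + 1)))

/-- Tameness of a multiarrangement: `pd_S Ω^p(A,m) ≤ p` for all `0 ≤ p ≤ ℓ`. -/
def TameM (A : Arrangement K ℓ) (m : (Fin ℓ → K) → ℕ) : Prop :=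
  ∀ p : ℕ, p ≤ ℓ → pdLE (PS K ℓ) p (Omega A m p)

/-- Tameness of a simple arrangement (constant multiplicity `1`). -/
def Tame (A : Arrangement K ℓ) : Prop := TameM A (fun _ => 1)

/-- Freeness of a multiarrangement: `Ω^1(A,m)` is a free `S`-module. -/
def FreeM (A : Arrangement K ℓ) (m : (Fin ℓ → K) → ℕ) : Prop :=
  Module.Free (PS K ℓ) (Omega A m 1)

/-- An arrangement is essential when the intersection of its hyperplanes is `{0}`,
equivalently the defining forms span the dual space. -/
def Essential (A : Arrangement K ℓ) : Prop :=
  Submodule.span K (A.hyps : Set (Fin ℓ → K)) = ⊤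

/-- The localization `A_x = {H ∈ A : x ∈ H}` of an arrangement at a point `x`. -/
def locArr (A : Arrangement K ℓ) (x : Fin ℓ → K) : Arrangement K ℓ where
  hyps := A.hyps.filter (fun c => ∑ i, c i * x i = 0)
  ne_zero := fun c hc => A.ne_zero c (Finset.mem_filter.mp hc).1
  nonprop := fun c hc c' hc' =>
    A.nonprop c (Finset.mem_filter.mp hc).1 c' (Finset.mem_filter.mp hc').1

/-- `(A,m)` is locally free along the hyperplane `{x : ∑ (c0)_i x_i = 0}` :
`(A_x, m_x)` is free for every nonzero point `x` of this hyperplane. -/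
def LocallyFreeAlong (A : Arrangement K ℓ) (m : (Fin ℓ → K) → ℕ) (c0 : Fin ℓ → K) : Prop :=
  ∀ x : Fin ℓ → K, x ≠ 0 → (∑ i, c0 i * x i = 0) → FreeM (locArr A x) m

/-- The deletion `A ∖ {H}`. -/
def delArr (A : Arrangement K ℓ) (c0 : Fin ℓ → K) : Arrangement K ℓ where
  hyps := A.hyps.erase c0
  ne_zero := fun c hc => A.ne_zero c (Finset.mem_of_mem_erase hc)
  nonprop := fun c hc c' hc' =>
    A.nonprop c (Finset.mem_of_mem_erase hc) c' (Finset.mem_of_mem_erase hc')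

/-- The coefficient vector of the restriction of the linear form `c` to the hyperplane `H`
along the linear identification `e : K^{ℓ-1} ≃ H`. -/
def restrictForm (e : (Fin (ℓ - 1) → K) →ₗ[K] (Fin ℓ → K)) (c : Fin ℓ → K) :
    Fin (ℓ - 1) → K := fun i => ∑ j, c j * e (Pi.single i 1) j

/-- The linear form on `K^ℓ` with coefficient vector `c`. -/
def dotLin (c : Fin ℓ → K) : (Fin ℓ → K) →ₗ[K] K := ∑ i, c i • LinearMap.proj i

/-- `e` identifies `K^{ℓ-1}` with the hyperplane `ker(α_{c0})`. -/
def IsHypEmbedding (c0 : Fin ℓ → K) (e : (Fin (ℓ - 1) → K) →ₗ[K] (Fin ℓ → K)) : Prop :=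
  Function.Injective e ∧ LinearMap.range e = LinearMap.ker (dotLin c0)

/-- `B` (an arrangement in `K^{ℓ-1}`) represents the restriction `A^H` of `A` to the
hyperplane `H` determined by `c0 ∈ A`, via the identification `e : K^{ℓ-1} ≃ H`:
its hyperplanes are exactly the restrictions to `H` of the hyperplanes of `A ∖ {H}`. -/
def IsRestrictionOf (B : Arrangement K (ℓ - 1)) (A : Arrangement K ℓ) (c0 : Fin ℓ → K)
    (e : (Fin (ℓ - 1) → K) →ₗ[K] (Fin ℓ → K)) : Prop :=
  (∀ c ∈ A.hyps, c ≠ c0 → ∃ c' ∈ B.hyps, ∃ t : K, t ≠ 0 ∧ restrictForm e c = t • c') ∧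
  (∀ c' ∈ B.hyps, ∃ c ∈ A.hyps, c ≠ c0 ∧ ∃ t : K, t ≠ 0 ∧ restrictForm e c = t • c')
/-- The Ziegler multiplicity `m^H` on the restriction: `m^H(X) = #{L ∈ A∖{H} : L ∩ H = X}`. -/
def zieglerMult (A : Arrangement K ℓ) (c0 : Fin ℓ → K)
    (e : (Fin (ℓ - 1) → K) →ₗ[K] (Fin ℓ → K)) (c' : Fin (ℓ - 1) → K) : ℕ :=
  (A.hyps.filter (fun c => c ≠ c0 ∧ ∃ t : K, t ≠ 0 ∧ restrictForm e c = t • c')).card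

/-- The wedge `dx_{i_1} ∧ ⋯ ∧ dx_{i_p}` for a list of indices. -/
def wedgeList (l : List (Fin ℓ)) : ExtF K ℓ :=
  (l.map (fun i => ExteriorAlgebra.ι (PS K ℓ) (Pi.single i (1 : PS K ℓ)))).prod

/-- A polynomial `p`-form is homogeneous of (coefficient) degree `d` if it is a sum of
terms `f · dx_{i_1} ∧ ⋯ ∧ dx_{i_p}` with `f` homogeneous of degree `d`. -/
def IsHomogForm (p d : ℕ) (η : ExtF K ℓ) : Prop :=
  η ∈ AddSubgroup.closure {ξ : ExtF K ℓ | ∃ (f : PS K ℓ) (l : List (Fin ℓ)),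
    f.IsHomogeneous d ∧ l.length = p ∧ ξ = f • wedgeList l}

/-- `|m| = ∑_{H ∈ A} m(H)`. -/
def msum (A : Arrangement K ℓ) (m : (Fin ℓ → K) → ℕ) : ℕ := ∑ c ∈ A.hyps, m c

/-- The multiarrangement `(A,m)` is free with exponents `(d_1, …, d_ℓ)`: the polynomial
model of `Ω^1(A,m)` has a homogeneous basis whose `i`-th member has coefficient degree
`|m| - d_i`. -/
def FreeWithExp (A : Arrangement K ℓ) (m : (Fin ℓ → K) → ℕ) (d : Fin ℓ → ℕ) : Prop :=
  ∃ b : Fin ℓ → ExtF K ℓ,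
    (∀ i, b i ∈ Omega A m 1) ∧
    (∀ i, IsHomogForm 1 (msum A m - d i) (b i)) ∧
    LinearIndependent (PS K ℓ) b ∧
    Omega A m 1 ≤ Submodule.span (PS K ℓ) (Set.range b)

/-- The exponent vector `(d_1, d_2, 0, …, 0)`. -/
def expVec (d1 d2 : ℕ) : Fin ℓ → ℕ := fun i =>
  if (i : ℕ) = 0 then d1 else if (i : ℕ) = 1 then d2 else 0

/-- The localization `A_X` of `A` at the lattice element `X = H ∩ L` corresponding,
via the identification `e` of `H` with `K^{ℓ-1}`, to the hyperplane of `H`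
with coefficient vector `c'`. -/
def locOnRestr (A : Arrangement K ℓ) (e : (Fin (ℓ - 1) → K) →ₗ[K] (Fin ℓ → K))
    (c' : Fin (ℓ - 1) → K) : Arrangement K ℓ where
  hyps := A.hyps.filter (fun c => ∃ t : K, restrictForm e c = t • c')
  ne_zero := fun c hc => A.ne_zero c (Finset.mem_filter.mp hc).1
  nonprop := fun c hc c'' hc'' =>
    A.nonprop c (Finset.mem_filter.mp hc).1 c'' (Finset.mem_filter.mp hc'').1

/-- The multiplicity `m - δ_H`. -/
def mdel (m : (Fin ℓ → K) → ℕ) (c0 : Fin ℓ → K) : (Fin ℓ → K) → ℕ :=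
  fun c => if c = c0 then m c - 1 else m c

/-- `ms` is the Euler multiplicity `m^*` on the restriction `B = A^H` (presented via the
identification `e`): for each `X ∈ A^H` the rank-two localization `(A_X, m_X)` is free
with exponents `(d_1^X, d_2^X, 0, …, 0)` ordered so that `(A_X, m_X - δ_H)` is free with
exponents `(d_1^X - 1, d_2^X, 0, …, 0)`, and `m^*(X) = d_2^X`. -/
def IsEulerMult (A : Arrangement K ℓ) (m : (Fin ℓ → K) → ℕ) (c0 : Fin ℓ → K)
    (e : (Fin (ℓ - 1) → K) →ₗ[K] (Fin ℓ → K)) (B : Arrangement K (ℓ - 1))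
    (ms : (Fin (ℓ - 1) → K) → ℕ) : Prop :=
  ∀ c' ∈ B.hyps, ∃ d1 d2 : ℕ,
    FreeWithExp (locOnRestr A e c') m (expVec d1 d2) ∧
    FreeWithExp (locOnRestr A e c') (mdel m c0) (expVec (d1 - 1) d2) ∧
    ms c' = d2

/-- An arrangement is generic if any `k ≤ ℓ-1` of its hyperplanes intersect in
codimension `k`, i.e. any `≤ ℓ-1` of its defining forms are linearly independent. -/
def GenericArr (A : Arrangement K ℓ) : Prop :=
  ∀ s : Finset (Fin ℓ → K), s ⊆ A.hyps → s.card ≤ ℓ - 1 →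
    LinearIndependent K (fun x : {c // c ∈ s} => (x : Fin ℓ → K))

/-- An arrangement is irreducible if it is not a product of two lower-dimensional
arrangements, i.e. its defining forms cannot be split into two complementary proper
subspaces of the dual space. -/
def IrreducibleArr (A : Arrangement K ℓ) : Prop :=
  ¬ ∃ U1 U2 : Submodule K (Fin ℓ → K), U1 ≠ ⊥ ∧ U2 ≠ ⊥ ∧ U1 ⊓ U2 = ⊥ ∧ U1 ⊔ U2 = ⊤ ∧
      ∀ c ∈ A.hyps, c ∈ U1 ∨ c ∈ U2

/-- The defining polynomial `Q(A,m) = ∏_{H ∈ A} α_H^{m(H)}`. -/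
def Qpoly (A : Arrangement K ℓ) (m : (Fin ℓ → K) → ℕ) : PS K ℓ :=
  ∏ c ∈ A.hyps, linP c ^ m c

section ProjectiveDimension

open CategoryTheory

variable {R : Type} [CommRing R]

/-- The module `M` has projective dimension at most `n`, in the sense of `Ext`-vanishing. -/
def PdLE (R : Type) [CommRing R] (n : ℕ) (M : Type) [AddCommGroup M] [Module R M] : Prop :=
  HasProjectiveDimensionLE (ModuleCat.of R M) n

section
variable {M N P : Type} [AddCommGroup M] [Module R M] [AddCommGroup N] [Module R N]
  [AddCommGroup P] [Module R P]

lemma pdLE_zero_iff : PdLE R 0 M ↔ Module.Projective R M := by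
  rw [PdLE, ← projective_iff_hasProjectiveDimensionLE_zero, ← IsProjective.iff_projective]

lemma PdLE.of_equiv {n : ℕ} (h : PdLE R n M) (e : M ≃ₗ[R] N) : PdLE R n N :=
  have : HasProjectiveDimensionLT (ModuleCat.of R M) (n + 1) := h
  hasProjectiveDimensionLT_of_iso e.toModuleIso (n + 1)

lemma PdLE.mono {n k : ℕ} (h : PdLE R n M) (hnk : n ≤ k) : PdLE R k M :=
  have : HasProjectiveDimensionLT (ModuleCat.of R M) (n + 1) := h
  hasProjectiveDimensionLT_of_ge (ModuleCat.of R M) (n + 1) (k + 1) (by omega)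

variable {f : M →ₗ[R] N} {g : N →ₗ[R] P}

/-- The short exact sequence of `ModuleCat` attached to exact linear maps. -/
lemma shortExact_of_linearMap (hf : Function.Injective f) (hfg : Function.Exact f g)
    (hg : Function.Surjective g) :
    (ModuleCat.shortComplexOfCompEqZero f g hfg.linearMap_comp_eq_zero).ShortExact :=
  ModuleCat.shortComplex_shortExact _ hfg hf hg

lemma PdLE.middle {n : ℕ} (hf : Function.Injective f) (hfg : Function.Exact f g)
    (hg : Function.Surjective g) (hM : PdLE R n M) (hP : PdLE R n P) : PdLE R n N :=
  (shortExact_of_linearMap hf hfg hg).hasProjectiveDimensionLT_X₂ (n + 1) hM hP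

lemma PdLE.right {n : ℕ} (hf : Function.Injective f) (hfg : Function.Exact f g)
    (hg : Function.Surjective g) (hM : PdLE R n M) (hN : PdLE R (n + 1) N) :
    PdLE R (n + 1) P :=
  (shortExact_of_linearMap hf hfg hg).hasProjectiveDimensionLT_X₃ (n + 1) hM hN

lemma PdLE.left {n : ℕ} (hf : Function.Injective f) (hfg : Function.Exact f g)
    (hg : Function.Surjective g) (hN : PdLE R n N) (hP : PdLE R (n + 1) P) : PdLE R n M :=
  (shortExact_of_linearMap hf hfg hg).hasProjectiveDimensionLT_X₁ (n + 1) hN hP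

lemma exact_subtype_ker (g : N →ₗ[R] P) : Function.Exact (LinearMap.ker g).subtype g :=
  LinearMap.exact_subtype_ker_map g

end

lemma pdLE_iff_PdLE (n : ℕ) (M : Type) [AddCommGroup M] [Module R M] :
    pdLE R n M ↔ PdLE R n M := by
  induction n generalizing M with
  | zero => exact pdLE_zero_iff.symm
  | succ n ih =>
    constructor
    · rintro ⟨ι, f, hf, h⟩
      exact PdLE.right (Submodule.subtype_injective _) (exact_subtype_ker f) hf ((ih _).1 h)
        ((pdLE_zero_iff.2 inferInstance).mono (Nat.zero_le _))
    · intro h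
      refine ⟨M, Finsupp.linearCombination R id, Finsupp.linearCombination_id_surjective R M, ?_⟩
      exact (ih _).2 (PdLE.left (Submodule.subtype_injective _) (exact_subtype_ker _)
        (Finsupp.linearCombination_id_surjective R M)
        ((pdLE_zero_iff.2 inferInstance).mono (Nat.zero_le _)) h)

lemma pdim_eq_iff (n : ℕ) (M : Type) [AddCommGroup M] [Module R M] :
    pdim R M = n ↔ PdLE R n M ∧ ∀ k < n, ¬ PdLE R k M := by
  constructor
  · intro h
    have hne : {n : ℕ∞ | ∃ k : ℕ, pdLE R k M ∧ n = (k : ℕ∞)}.Nonempty := by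
      by_contra! hempty
      rw [pdim, hempty, sInf_empty] at h
      exact ENat.top_ne_natCast n h
    obtain ⟨k, hk, hkn⟩ := csInf_mem hne
    change pdim R M = k at hkn
    obtain rfl : n = k := by exact_mod_cast h.symm.trans hkn
    refine ⟨(pdLE_iff_PdLE _ _).1 hk, fun j hj hjM => ?_⟩
    have : pdim R M ≤ j := sInf_le ⟨j, (pdLE_iff_PdLE _ _).2 hjM, rfl⟩
    rw [h] at this
    exact absurd (by exact_mod_cast this) (not_le.2 hj)
  · rintro ⟨h, h'⟩
    refine le_antisymm (sInf_le ⟨n, (pdLE_iff_PdLE _ _).2 h, rfl⟩) (le_sInf ?_)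
    rintro _ ⟨k, hk, rfl⟩
    by_contra! hlt
    exact h' k (by exact_mod_cast hlt) ((pdLE_iff_PdLE _ _).1 hk)

/-- Extension of scalars along a flat ring map does not increase projective dimension. -/
lemma PdLE.baseChange {R' : Type} [CommRing R'] [Algebra R R'] [Module.Flat R R'] {n : ℕ}
    {M : Type} [AddCommGroup M] [Module R M] (h : PdLE R n M) :
    PdLE R' n (TensorProduct R R' M) := by
  rw [← pdLE_iff_PdLE] at h
  induction n generalizing M with
  | zero =>
    have : Module.Projective R M := h
    exact pdLE_zero_iff.2 inferInstance
  | succ n ih =>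
    obtain ⟨ι, f, hf, h⟩ := h
    refine PdLE.right (f := (LinearMap.ker f).subtype.baseChange R') (g := f.baseChange R')
      ?_ ?_ ?_ (ih h) ((pdLE_zero_iff.2 inferInstance).mono (Nat.zero_le _))
    · exact Module.Flat.lTensor_preserves_injective_linearMap _ (Submodule.subtype_injective _)
    · have := lTensor_exact (M := LinearMap.ker f) (f := (LinearMap.ker f).subtype) (g := f) R'
      exact this (exact_subtype_ker f) hf
    · exact LinearMap.lTensor_surjective R' hf

end ProjectiveDimension

section HilbertSyzygy

open Polynomial PolynomialModule

section PolynomialRing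

variable {R : Type} [CommRing R] {M : Type} [AddCommGroup M] [Module R M]

lemma X_pow_smul_single (n k : ℕ) (x : M) :
    (Polynomial.X ^ n : R[X]) • single R k x = single R (n + k) x := by
  rw [← Polynomial.monomial_one_right_eq_X_pow, monomial_smul_single, one_smul]

variable [Module R[X] M] [IsScalarTower R R[X] M]

/-- The `R[X]`-linear evaluation `M[X] → M` of an `R[X]`-module `M`. -/
def polyEval (R : Type) [CommRing R] (M : Type) [AddCommGroup M] [Module R M] [Module R[X] M]
    [IsScalarTower R R[X] M] : PolynomialModule R M →ₗ[R[X]] M :=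
  ((LinearMap.id : M →ₗ[R] M).liftBaseChange R[X]) ∘ₗ
    (polynomialTensorProductLEquivPolynomialModule R M).symm.toLinearMap

lemma polyEval_single (n : ℕ) (x : M) :
    polyEval R M (single R n x) = (Polynomial.X ^ n : R[X]) • x := by
  have h : single R n x = (Polynomial.X ^ n : R[X]) • single R 0 x := by
    rw [X_pow_smul_single, add_zero]
  have h0 : (polynomialTensorProductLEquivPolynomialModule R M).symm (single R 0 x)
      = (1 : R[X]) ⊗ₜ[R] x := by
    rw [LinearEquiv.symm_apply_eq]
    change _ = (LinearMap.liftBaseChange R[X] (lsingle R (M := M) 0)) _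
    rw [LinearMap.liftBaseChange_tmul, one_smul]
    rfl
  rw [h, _root_.map_smul]
  congr 1
  rw [polyEval, LinearMap.comp_apply, LinearEquiv.coe_coe, h0, LinearMap.liftBaseChange_tmul,
    one_smul, LinearMap.id_apply]

/-- The map `X - x` on `M[X]`, where `x` is the action of `X` on `M`. -/
def polyShift (R : Type) [CommRing R] (M : Type) [AddCommGroup M] [Module R M] [Module R[X] M]
    [IsScalarTower R R[X] M] : PolynomialModule R M →ₗ[R[X]] PolynomialModule R M :=
  LinearMap.lsmul R[X] _ Polynomial.X -
    { toFun := PolynomialModule.map R (Algebra.lsmul R R M (Polynomial.X : R[X]))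
      map_add' := map_add _
      map_smul' := fun p g => by
        rw [PolynomialModule.map_smul]
        simp }

lemma polyShift_single (n : ℕ) (x : M) : polyShift R M (single R n x) =
    single R (n + 1) x - single R n ((Polynomial.X : R[X]) • x) := by
  change (Polynomial.X : R[X]) • single R n x - PolynomialModule.map R _ (single R n x) = _
  rw [PolynomialModule.map_single]
  congr 1
  have := X_pow_smul_single (R := R) 1 n x
  rwa [pow_one, add_comm] at this

lemma coeff_polyShift (g : PolynomialModule R M) (n : ℕ) : (polyShift R M g).coeff (n + 1) =
    g.coeff n - (Polynomial.X : R[X]) • g.coeff (n + 1) := by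
  induction g using PolynomialModule.induction_linear with
  | zero => simp
  | add p q hp hq =>
    rw [map_add (polyShift R M), PolynomialModule.coeff_add, Finsupp.add_apply, hp, hq,
      PolynomialModule.coeff_add, Finsupp.add_apply, Finsupp.add_apply, smul_add]
    abel
  | single k x =>
    rw [polyShift_single]
    change (single R (k + 1) x).coeff (n + 1) - (single R k _).coeff (n + 1) = _
    simp only [coeff_single, Finsupp.single_apply, add_left_inj]
    split_ifs <;> simp

lemma polyShift_injective : Function.Injective (polyShift R M) := by
  rw [injective_iff_map_eq_zero]
  intro g hg
  have h : ∀ n, g.coeff n = (Polynomial.X : R[X]) • g.coeff (n + 1) := fun n => by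
    have := coeff_polyShift g n
    rw [hg] at this
    exact (sub_eq_zero.1 this.symm)
  have h0 : ∀ k n, g.coeff (n + k) = 0 → g.coeff n = 0 := by
    intro k
    induction k with
    | zero => exact fun n hn => hn
    | succ k ih =>
      intro n hn
      rw [h, ih (n + 1) (by rwa [add_right_comm]), smul_zero]
  ext n
  refine h0 (g.coeff.support.sup id + 1) n ?_
  by_contra hne
  have := Finset.le_sup (f := id) (Finsupp.mem_support_iff.2 hne)
  rw [id] at this
  omega

lemma polyShift_exact : Function.Exact (polyShift R M) (polyEval R M) := by
  have key : ∀ g : PolynomialModule R M,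
      g - single R 0 (polyEval R M g) ∈ LinearMap.range (polyShift R M) := by
    intro g
    induction g using PolynomialModule.induction_linear with
    | zero => simp
    | add p q hp hq =>
      rw [map_add, single_add, add_sub_add_comm]
      exact add_mem hp hq
    | single n x =>
      induction n generalizing x with
      | zero => simp [polyEval_single]
      | succ n ih =>
        have := add_mem (LinearMap.mem_range_self (polyShift R M) (single R n x))
          (ih ((Polynomial.X : R[X]) • x))
        rw [polyShift_single, polyEval_single, smul_smul, ← pow_succ] at this
        rw [polyEval_single]
        simpa using this
  intro g
  constructor
  · intro hg
    have := key g
    rwa [hg, single_zero, sub_zero] at this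
  · rintro ⟨g, rfl⟩
    induction g using PolynomialModule.induction_linear with
    | zero => simp
    | add p q hp hq => rw [map_add, map_add, hp, hq, add_zero]
    | single n x =>
      rw [polyShift_single, map_sub, polyEval_single, polyEval_single, smul_smul, pow_succ,
        sub_self]

lemma PdLE.polynomial {n : ℕ} (h : PdLE R n M) : PdLE R[X] (n + 1) M := by
  have h' : PdLE R[X] n (PolynomialModule R M) :=
    (h.baseChange (R' := R[X])).of_equiv (polynomialTensorProductLEquivPolynomialModule R M)
  refine PdLE.right polyShift_injective polyShift_exact (fun x => ⟨single R 0 x, ?_⟩) h'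
    (h'.mono n.le_succ)
  rw [polyEval_single, pow_zero, one_smul]

end PolynomialRing

lemma PdLE.of_ringEquiv {R R' : Type} [CommRing R] [CommRing R'] (e : R ≃+* R') {n : ℕ}
    (h : ∀ (M : Type) [AddCommGroup M] [Module R M], PdLE R n M)
    (M : Type) [AddCommGroup M] [Module R' M] : PdLE R' n M := by
  let _ : Module R M := Module.compHom M e.toRingHom
  have := RingHomInvPair.of_ringEquiv e
  have := RingHomInvPair.of_ringEquiv e.symm
  let e' : M ≃ₛₗ[RingHomClass.toRingHom e] M :=
    { AddEquiv.refl M with map_smul' := fun _ _ => rfl }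
  have : CategoryTheory.HasProjectiveDimensionLE (ModuleCat.of R M) n := h M
  exact ModuleCat.hasProjectiveDimensionLE_of_semiLinearEquiv (M := ModuleCat.of R M)
    (N := ModuleCat.of R' M) e e' n

/-- Hilbert's syzygy theorem. -/
lemma pdLE_mvPolynomial (ℓ : ℕ) (M : Type) [AddCommGroup M] [Module (PS K ℓ) M] :
    PdLE (PS K ℓ) ℓ M := by
  induction ℓ generalizing M with
  | zero =>
    refine PdLE.of_ringEquiv (MvPolynomial.isEmptyAlgEquiv K (Fin 0)).toRingEquiv.symm
      (fun M _ _ => pdLE_zero_iff.2 inferInstance) M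
  | succ ℓ ih =>
    refine PdLE.of_ringEquiv (MvPolynomial.finSuccEquiv K ℓ).toRingEquiv.symm
      (fun M _ _ => ?_) M
    let _ : Module (PS K ℓ) M := Module.compHom M (Polynomial.C : PS K ℓ →+* (PS K ℓ)[X])
    have : IsScalarTower (PS K ℓ) (PS K ℓ)[X] M := ⟨fun a p x => by
      rw [Polynomial.smul_eq_C_mul, mul_smul]
      rfl⟩
    exact (ih M).polynomial

/-- A submodule of a projective module over a polynomial ring in `n + 1` variables has
projective dimension at most `n`. -/
lemma pdLE_submodule {n : ℕ} {F : Type} [AddCommGroup F] [Module (PS K (n + 1)) F]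
    [Module.Projective (PS K (n + 1)) F] (N : Submodule (PS K (n + 1)) F) :
    PdLE (PS K (n + 1)) n N :=
  PdLE.left N.subtype_injective (LinearMap.exact_subtype_mkQ N) N.mkQ_surjective
    ((pdLE_zero_iff.2 inferInstance).mono n.zero_le) (pdLE_mvPolynomial (n + 1) _)

end HilbertSyzygy

section Depth

open CategoryTheory Abelian RingTheory.Sequence

section
variable {R : Type} [CommRing R]

lemma subsingleton_ext_of_isWeaklyRegular (N : ModuleCat R) (rs : List R)
    (hN : ∀ r ∈ rs, ∀ x : N, r • x = 0) (M : Type) [AddCommGroup M] [Module R M]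
    (h : IsWeaklyRegular M rs) (i : ℕ) (hi : i < rs.length) :
    Subsingleton (Ext N (ModuleCat.of R M) i) := by
  induction rs generalizing M i with
  | nil => simp at hi
  | cons r rs ih =>
    rw [isWeaklyRegular_cons_iff] at h
    have hS : (ModuleCat.smulShortComplex (ModuleCat.of R M) r).ShortExact :=
      IsSMulRegular.smulShortComplex_shortExact (M := ModuleCat.of R M) h.1
    have hr : r • 𝟙 N = 0 := by
      ext x
      exact hN r (by simp) x
    refine subsingleton_of_forall_eq 0 fun x => ?_
    have hx : x.comp (Ext.mk₀ (r • 𝟙 (ModuleCat.of R M))) (add_zero i) = 0 := by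
      rw [Ext.mk₀_smul, Ext.comp_smul, Ext.comp_mk₀_id, ← Ext.mk₀_id_comp x, ← Ext.smul_comp,
        ← Ext.mk₀_smul, hr, Ext.mk₀_zero, Ext.zero_comp]
    cases i with
    | zero =>
      have := hS.mono_f
      refine Ext.postcomp_mk₀_injective_of_mono N
        (ModuleCat.smulShortComplex (ModuleCat.of R M) r).f ?_
      exact hx.trans (map_zero ((Ext.mk₀ (ModuleCat.smulShortComplex (ModuleCat.of R M)
        r).f).postcomp N (add_zero 0))).symm
    | succ i =>
      obtain ⟨y, rfl⟩ := Ext.covariant_sequence_exact₁ N hS x hx rfl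
      have := ih (fun r hr => hN r (by simp [hr])) (QuotSMulTop r M) h.2 i (by simpa using hi)
      have hy : y = 0 := Subsingleton.elim (α := Ext N (ModuleCat.of R (QuotSMulTop r M)) i) _ _
      rw [hy]
      exact Ext.zero_comp _ _ hS.extClass _ _

lemma subsingleton_ext_of_surjective (X : ModuleCat R) {N P : Type} [AddCommGroup N] [Module R N]
    [AddCommGroup P] [Module R P] (g : N →ₗ[R] P) (hg : Function.Surjective g) (i : ℕ)
    (hN : Subsingleton (Ext X (ModuleCat.of R N) i))
    (hL : Subsingleton (Ext X (ModuleCat.of R (LinearMap.ker g)) (i + 1))) :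
    Subsingleton (Ext X (ModuleCat.of R P) i) := by
  have hS := shortExact_of_linearMap (Submodule.subtype_injective (LinearMap.ker g))
    (exact_subtype_ker g) hg
  refine subsingleton_of_forall_eq 0 fun x => ?_
  obtain ⟨y, rfl⟩ := Ext.covariant_sequence_exact₃ X hS x rfl
    (Subsingleton.elim (α := Ext X (ModuleCat.of R (LinearMap.ker g)) (i + 1)) _ _)
  have hy : y = 0 := Subsingleton.elim (α := Ext X (ModuleCat.of R N) i) _ _
  rw [hy]
  exact Ext.zero_comp _ _ (Ext.mk₀ (ModuleCat.ofHom g)) _ _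

end

/-- The ideal of `K[x_1, …, x_ℓ]` generated by the variables. -/
def maxIdeal (K : Type) [Field K] (ℓ : ℕ) : Ideal (PS K ℓ) :=
  Ideal.span (Set.range MvPolynomial.X)

/-- The list of variables of `K[x_1, …, x_ℓ]`. -/
def varList (K : Type) [Field K] (ℓ : ℕ) : List (PS K ℓ) :=
  (List.finRange ℓ).map MvPolynomial.X

lemma isWeaklyRegular_varList : IsWeaklyRegular (PS K ℓ) (varList K ℓ) := by
  refine ⟨fun i hi => ?_⟩
  have hi' : i < ℓ := by simpa [varList] using hi
  have hI : Ideal.ofList ((varList K ℓ).take i) =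
      Ideal.span (MvPolynomial.X '' {j : Fin ℓ | (j : ℕ) < i}) := by
    rw [Ideal.ofList]
    congr 1
    ext f
    simp only [varList, ← List.map_take, List.mem_map, Set.mem_ofPred_eq, Set.mem_image]
    refine exists_congr fun j => and_congr_left fun _ => ?_
    rw [List.mem_take_iff_getElem]
    simp only [List.getElem_finRange, List.length_finRange]
    constructor
    · rintro ⟨k, hk, rfl⟩
      simp at hk ⊢
      exact hk.1
    · intro hj
      exact ⟨j, by simp [hj], rfl⟩
  have hX : (varList K ℓ)[i] = MvPolynomial.X ⟨i, hi'⟩ := by simp [varList]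
  rw [isSMulRegular_iff_right_eq_zero_of_smul]
  intro x hx
  obtain ⟨f, rfl⟩ := Submodule.Quotient.mk_surjective _ x
  rw [← Submodule.Quotient.mk_smul, Submodule.Quotient.mk_eq_zero, smul_eq_mul, Ideal.mul_top, hI,
    hX, smul_eq_mul, MvPolynomial.mem_ideal_span_X_image] at hx
  rw [Submodule.Quotient.mk_eq_zero, smul_eq_mul, Ideal.mul_top, hI,
    MvPolynomial.mem_ideal_span_X_image]
  intro m hm
  obtain ⟨j, hj, hne⟩ := hx (m + Finsupp.single ⟨i, hi'⟩ 1) (by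
    rw [mul_comm, MvPolynomial.mem_support_iff, MvPolynomial.coeff_mul_X]
    exact MvPolynomial.mem_support_iff.1 hm)
  refine ⟨j, hj, ?_⟩
  rwa [Finsupp.add_apply, Finsupp.single_eq_of_ne, add_zero] at hne
  rintro rfl
  simp at hj

lemma isWeaklyRegular_varList_of_flat (M : Type) [AddCommGroup M] [Module (PS K ℓ) M]
    [Module.Flat (PS K ℓ) M] : IsWeaklyRegular M (varList K ℓ) :=
  ((TensorProduct.rid (PS K ℓ) M).isWeaklyRegular_congr _).1
    (isWeaklyRegular_varList.isWeaklyRegular_lTensor (M₂ := M))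

variable {M : Type} [AddCommGroup M] [Module (PS K ℓ) M]

lemma PdLE.subsingleton_ext_quotient {n i : ℕ} (h : PdLE (PS K ℓ) n M) (hin : i + n < ℓ) :
    Subsingleton (Ext (ModuleCat.of (PS K ℓ) (PS K ℓ ⧸ maxIdeal K ℓ))
      (ModuleCat.of (PS K ℓ) M) i) := by
  have hproj : ∀ (F : Type) [AddCommGroup F] [Module (PS K ℓ) F] [Module.Projective (PS K ℓ) F]
      (i : ℕ), i < ℓ → Subsingleton (Ext (ModuleCat.of (PS K ℓ) (PS K ℓ ⧸ maxIdeal K ℓ))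
        (ModuleCat.of (PS K ℓ) F) i) := by
    intro F _ _ _ i hi
    refine subsingleton_ext_of_isWeaklyRegular _ (varList K ℓ) ?_ F
      (isWeaklyRegular_varList_of_flat F) i (by simpa [varList] using hi)
    intro r hr x
    obtain ⟨f, rfl⟩ := Submodule.Quotient.mk_surjective _ x
    change r • (Submodule.Quotient.mk f : PS K ℓ ⧸ maxIdeal K ℓ) = 0
    rw [← Submodule.Quotient.mk_smul, Submodule.Quotient.mk_eq_zero, smul_eq_mul]
    refine Ideal.mul_mem_right _ _ (Ideal.subset_span ?_)
    simp only [varList, List.mem_map] at hr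
    obtain ⟨j, -, rfl⟩ := hr
    exact ⟨j, rfl⟩
  rw [← pdLE_iff_PdLE] at h
  induction n generalizing M i with
  | zero =>
    have : Module.Projective (PS K ℓ) M := h
    exact hproj M i (by omega)
  | succ n ih =>
    obtain ⟨ι, f, hf, h⟩ := h
    exact subsingleton_ext_of_surjective _ f hf i (hproj (ι →₀ PS K ℓ) i (by omega))
      (ih h (by omega))

/-- A module of small projective dimension has no element killed by the maximal ideal. -/
lemma PdLE.eq_zero_of_smul_eq_zero {n : ℕ} (h : PdLE (PS K ℓ) n M) (hn : n < ℓ) {u : M}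
    (hu : ∀ a ∈ maxIdeal K ℓ, a • u = 0) : u = 0 := by
  have := h.subsingleton_ext_quotient (i := 0) (by omega)
  have : Subsingleton ((PS K ℓ ⧸ maxIdeal K ℓ) →ₗ[PS K ℓ] M) :=
    (Ext.addEquiv₀.trans (ModuleCat.homAddEquiv (M := ModuleCat.of (PS K ℓ)
      (PS K ℓ ⧸ maxIdeal K ℓ)) (N := ModuleCat.of (PS K ℓ) M))).symm.subsingleton
  have hle : maxIdeal K ℓ ≤ LinearMap.ker (LinearMap.toSpanSingleton (PS K ℓ) M u) :=
    fun a ha => hu a ha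
  have h0 := LinearMap.congr_fun (Subsingleton.elim (Submodule.liftQ _ _ hle) 0)
    (Submodule.Quotient.mk 1)
  rw [Submodule.liftQ_apply, LinearMap.toSpanSingleton_apply, one_smul] at h0
  exact h0

/-- A submodule of small projective dimension of a torsion-free module is saturated with respect
to the maximal ideal. -/
lemma PdLE.mem_of_smul_mem {n : ℕ} {N : Type} [AddCommGroup N] [Module (PS K ℓ) N]
    [Module.IsTorsionFree (PS K ℓ) N] {W : Submodule (PS K ℓ) N} (h : PdLE (PS K ℓ) n W)
    (hn : n + 2 ≤ ℓ) {y : N} (hy : ∀ a ∈ maxIdeal K ℓ, a • y ∈ W) : y ∈ W := by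
  have hS := shortExact_of_linearMap (maxIdeal K ℓ).subtype_injective
    (LinearMap.exact_subtype_mkQ (maxIdeal K ℓ)) (Submodule.mkQ_surjective _)
  let φ : maxIdeal K ℓ →ₗ[PS K ℓ] W := LinearMap.codRestrict W
    ((LinearMap.toSpanSingleton (PS K ℓ) N y) ∘ₗ (maxIdeal K ℓ).subtype) fun a => hy a a.2
  have hsub := h.subsingleton_ext_quotient (i := 1) (by omega)
  obtain ⟨x, hx⟩ := Ext.contravariant_sequence_exact₁ hS (ModuleCat.of (PS K ℓ) W)
    (Ext.mk₀ (ModuleCat.ofHom φ)) rfl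
    (Subsingleton.elim (α := Ext (ModuleCat.of (PS K ℓ) (PS K ℓ ⧸ maxIdeal K ℓ))
      (ModuleCat.of (PS K ℓ) W) 1) _ _)
  obtain ⟨ψ, rfl⟩ : ∃ ψ : PS K ℓ →ₗ[PS K ℓ] W, x = Ext.mk₀ (ModuleCat.ofHom ψ) :=
    ⟨(Ext.addEquiv₀ x).hom, (Ext.mk₀_addEquiv₀_apply x).symm⟩
  have hψ : ∀ a : maxIdeal K ℓ, ψ a = φ a := by
    rw [Ext.mk₀_comp_mk₀] at hx
    have h1 := (Ext.mk₀_bijective (ModuleCat.of (PS K ℓ) (maxIdeal K ℓ))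
      (ModuleCat.of (PS K ℓ) W)).1 hx
    intro a
    exact congrArg (fun f => f.hom a) h1
  have hX : (MvPolynomial.X ⟨0, by omega⟩ : PS K ℓ) ∈ maxIdeal K ℓ := Ideal.subset_span ⟨_, rfl⟩
  have hw : (ψ 1 : N) = y := by
    refine smul_right_injective N (MvPolynomial.X_ne_zero (R := K) (⟨0, by omega⟩ : Fin ℓ)) ?_
    have h1 := congr_arg Subtype.val (hψ ⟨_, hX⟩)
    change _ = (MvPolynomial.X ⟨0, by omega⟩ : PS K ℓ) • y at h1
    change (MvPolynomial.X ⟨0, by omega⟩ : PS K ℓ) • (ψ 1 : N) = MvPolynomial.X _ • y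
    rw [← h1, ← Submodule.coe_smul, ← map_smul, smul_eq_mul, mul_one]
  exact hw ▸ (ψ 1).2

/-- Saturation with respect to the maximal ideal upgrades to saturation with respect to any ideal
whose radical contains the maximal ideal. -/
lemma mem_of_le_radical {W : Submodule (PS K ℓ) M}
    (hW : ∀ z : M, (∀ a ∈ maxIdeal K ℓ, a • z ∈ W) → z ∈ W) {J : Ideal (PS K ℓ)}
    (hJ : maxIdeal K ℓ ≤ J.radical) {y : M} (hy : ∀ a ∈ J, a • y ∈ W) : y ∈ W := by
  obtain ⟨k, hk⟩ := Ideal.exists_pow_le_of_le_radical_of_fg hJ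
    (⟨Finset.univ.image MvPolynomial.X, by simp [maxIdeal]⟩)
  have key : ∀ k (z : M), (∀ a ∈ maxIdeal K ℓ ^ k, a • z ∈ W) → z ∈ W := by
    intro k
    induction k with
    | zero => exact fun z hz => one_smul (PS K ℓ) z ▸ hz 1 (by simp)
    | succ k ih =>
      refine fun z hz => ih z fun a ha => hW _ fun b hb => ?_
      rw [smul_smul]
      exact hz _ (by rw [pow_succ']; exact Ideal.mul_mem_mul hb ha)
  exact key k y fun a ha => hy a (hk ha)

/-- The product of the powers of the defining forms of the hyperplanes not containing `x`. -/
def awayPoly (A : Arrangement K ℓ) (m : (Fin ℓ → K) → ℕ) (x : Fin ℓ → K) : PS K ℓ :=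
  ∏ c ∈ A.hyps.filter (fun c => ¬ ∑ i, c i * x i = 0), linP c ^ m c

lemma maxIdeal_le_radical (A : Arrangement K ℓ) (m : (Fin ℓ → K) → ℕ) {J : Ideal (PS K ℓ)}
    (hJ : ∀ x : Fin ℓ → K, x ≠ 0 → ∃ k : ℕ, awayPoly A m x ^ k ∈ J) :
    maxIdeal K ℓ ≤ J.radical := by
  rw [Ideal.radical_eq_sInf]
  refine le_sInf ?_
  rintro P ⟨hJP, hP⟩
  rw [maxIdeal, Ideal.span_le]
  let lin : (Fin ℓ → K) →ₗ[K] PS K ℓ :=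
    ∑ i, (LinearMap.proj i).smulRight (MvPolynomial.X i : PS K ℓ)
  have hlin : ∀ c, lin c = linP c := fun c => by
    simp [lin, linP, MvPolynomial.smul_eq_C_mul]
  let L : Submodule K (Fin ℓ → K) := Submodule.comap lin (P.restrictScalars K)
  have hL : ∀ c, c ∈ L ↔ linP c ∈ P := fun c => by
    rw [← hlin]
    rfl
  by_cases hLt : L = ⊤
  · rintro _ ⟨j, rfl⟩
    have h1 := (hL (Pi.single j 1)).1 (hLt ▸ Submodule.mem_top)
    have h2 : linP (Pi.single j (1 : K)) = (MvPolynomial.X j : PS K ℓ) := by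
      rw [linP, Finset.sum_eq_single j] <;> simp +contextual
    rwa [h2] at h1
  · exfalso
    obtain ⟨f, hf, hfL⟩ := Submodule.exists_le_ker_of_lt_top L (lt_top_iff_ne_top.2 hLt)
    have hfx : ∀ c, f c = ∑ i, c i * f (Pi.single i 1) := fun c => by
      conv_lhs => rw [← Finset.univ_sum_single c]
      rw [map_sum]
      refine Finset.sum_congr rfl fun i _ => ?_
      rw [← smul_eq_mul, ← map_smul, ← Pi.single_smul, smul_eq_mul, mul_one]
    obtain ⟨k, hk⟩ := hJ (fun i => f (Pi.single i 1)) (by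
      intro h0
      refine hf (LinearMap.ext fun c => ?_)
      rw [hfx]
      exact Finset.sum_eq_zero fun i _ => by rw [congr_fun h0 i]; simp)
    have h1 := hP.mem_of_pow_mem _ (hJP hk)
    rw [awayPoly, hP.prod_mem_iff] at h1
    obtain ⟨c, hc, hcP⟩ := h1
    refine (Finset.mem_filter.1 hc).2 ?_
    rw [← hfx]
    exact hfL ((hL c).2 (hP.mem_of_pow_mem _ hcP))

/-- A submodule of small projective dimension of a torsion-free module contains every element
moved into it by powers of the polynomials `awayPoly`. -/
lemma PdLE.mem_of_awayPoly {n : ℕ} {N : Type} [AddCommGroup N] [Module (PS K ℓ) N]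
    [Module.IsTorsionFree (PS K ℓ) N] {W : Submodule (PS K ℓ) N} (h : PdLE (PS K ℓ) n W)
    (hn : n + 2 ≤ ℓ) (A : Arrangement K ℓ) (m : (Fin ℓ → K) → ℕ) {y : N}
    (hy : ∀ x : Fin ℓ → K, x ≠ 0 → ∃ k : ℕ, awayPoly A m x ^ k • y ∈ W) : y ∈ W :=
  mem_of_le_radical (fun _ hz => h.mem_of_smul_mem hn hz)
    (maxIdeal_le_radical A m (J := Submodule.comap (LinearMap.toSpanSingleton (PS K ℓ) N y) W)
      fun x hx => hy x hx) fun _ ha => ha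

lemma PdLE.eq_zero_of_awayPoly {n : ℕ} (h : PdLE (PS K ℓ) n M) (hn : n < ℓ)
    (A : Arrangement K ℓ) (m : (Fin ℓ → K) → ℕ) {u : M}
    (hu : ∀ x : Fin ℓ → K, x ≠ 0 → ∃ k : ℕ, awayPoly A m x ^ k • u = 0) : u = 0 :=
  (Submodule.mem_bot (PS K ℓ)).1 <| mem_of_le_radical
    (fun _ hz => (Submodule.mem_bot _).2 (h.eq_zero_of_smul_eq_zero hn fun a ha =>
      (Submodule.mem_bot _).1 (hz a ha)))
    (maxIdeal_le_radical A m (J := LinearMap.ker (LinearMap.toSpanSingleton (PS K ℓ) M u))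
      fun x hx => hu x hx) fun _ ha => (Submodule.mem_bot _).2 ha

end Depth

section ExteriorSequence

open ExteriorAlgebra

variable {R : Type} [CommRing R] {M M' : Type} [AddCommGroup M] [Module R M]
  [AddCommGroup M'] [Module R M']

lemma ι_mul_ι_mul_comm (s m : M) (a : ExteriorAlgebra R M) :
    ι R m * (ι R s * a) = ι R s * (-(ι R m * a)) := by
  rw [mul_neg, ← mul_assoc, ← mul_assoc, ← neg_mul, eq_neg_of_add_eq_zero_left (ι_add_mul_swap m s)]

/-- The kernel of the map of exterior algebras induced by `M → M / (s)` is generated by `s`. -/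
lemma exists_eq_ι_mul_of_map_eq_zero {π : M →ₗ[R] M'} (hπ : Function.Surjective π) {s : M}
    (hs : LinearMap.ker π = Submodule.span R {s}) {a : ExteriorAlgebra R M}
    (ha : ExteriorAlgebra.map π a = 0) : ∃ u, a = ι R s * u := by
  let I : Submodule R (ExteriorAlgebra R M) := LinearMap.range (LinearMap.mulLeft R (ι R s))
  have hI : ∀ m : M, I ≤ I.comap (LinearMap.mulLeft R (ι R m)) := by
    rintro m _ ⟨a, rfl⟩
    exact ⟨_, (ι_mul_ι_mul_comm s m a).symm⟩
  let L : M →ₗ[R] Module.End R (ExteriorAlgebra R M ⧸ I) :=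
    { toFun := fun m => I.mapQ I (LinearMap.mulLeft R (ι R m)) (hI m)
      map_add' := fun x y => by
        refine LinearMap.ext fun b => ?_
        obtain ⟨b, rfl⟩ := I.mkQ_surjective b
        simp [add_mul]
      map_smul' := fun r x => by
        refine LinearMap.ext fun b => ?_
        obtain ⟨b, rfl⟩ := I.mkQ_surjective b
        simp }
  have hL : ∀ m b, L m (I.mkQ b) = I.mkQ (ι R m * b) := fun m b => rfl
  have hker : LinearMap.ker π ≤ LinearMap.ker L := by
    rw [hs, Submodule.span_singleton_le_iff_mem, LinearMap.mem_ker]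
    refine LinearMap.ext fun b => ?_
    obtain ⟨b, rfl⟩ := I.mkQ_surjective b
    rw [hL, LinearMap.zero_apply, Submodule.mkQ_apply, Submodule.Quotient.mk_eq_zero]
    exact ⟨b, rfl⟩
  let L' : M' →ₗ[R] Module.End R (ExteriorAlgebra R M ⧸ I) :=
    (LinearMap.ker π).liftQ L hker ∘ₗ (π.quotKerEquivOfSurjective hπ).symm.toLinearMap
  have hL' : ∀ m, L' (π m) = L m := fun m => by
    have h : (π.quotKerEquivOfSurjective hπ).symm (π m) = (LinearMap.ker π).mkQ m := by
      rw [LinearEquiv.symm_apply_eq]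
      rfl
    change (LinearMap.ker π).liftQ L hker ((π.quotKerEquivOfSurjective hπ).symm (π m)) = _
    rw [h]
    rfl
  let ψ := ExteriorAlgebra.lift R ⟨L', fun m' => by
    obtain ⟨m, rfl⟩ := hπ m'
    refine LinearMap.ext fun b => ?_
    obtain ⟨b, rfl⟩ := I.mkQ_surjective b
    rw [hL', Module.End.mul_apply, hL, hL, ← mul_assoc, ι_sq_zero, zero_mul, map_zero]
    rfl⟩
  have key : ∀ a b, ψ (ExteriorAlgebra.map π a) (I.mkQ b) = I.mkQ (a * b) := by
    intro a
    induction a using ExteriorAlgebra.induction with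
    | algebraMap r =>
      intro b
      simp [Module.algebraMap_end_apply, ← Algebra.smul_def]
    | ι m =>
      intro b
      rw [map_apply_ι, lift_ι_apply, hL', hL]
    | mul x y hx hy =>
      intro b
      rw [map_mul, map_mul, Module.End.mul_apply, hy, hx, mul_assoc]
    | add x y hx hy =>
      intro b
      rw [map_add, map_add, LinearMap.add_apply, hy, hx, add_mul, map_add]
  have h1 := key a 1
  rw [ha, map_zero, LinearMap.zero_apply, mul_one, eq_comm, Submodule.mkQ_apply,
    Submodule.Quotient.mk_eq_zero] at h1
  obtain ⟨u, hu⟩ := h1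
  exact ⟨u, hu.symm⟩

lemma exists_mem_exteriorPower_eq_ι_mul {s : M} {p : ℕ} {u : ExteriorAlgebra R M}
    (h : ι R s * u ∈ ⋀[R]^(p + 1) M) : ∃ v ∈ ⋀[R]^p M, ι R s * u = ι R s * v := by
  have hs : ι R s ∈ ⋀[R]^1 M := by
    rw [exteriorPower, pow_one]
    exact LinearMap.mem_range_self _ s
  have h1 := DirectSum.coe_decompose_mul_add_of_left_mem (fun i : ℕ => ⋀[R]^i M) (j := p)
    (b := u) hs
  rw [add_comm, DirectSum.decompose_of_mem_same (fun i : ℕ => ⋀[R]^i M) h] at h1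
  exact ⟨_, SetLike.coe_mem _, h1⟩

lemma coe_exteriorPower_map (f : M →ₗ[R] M') (p : ℕ) (u : ⋀[R]^p M) :
    (exteriorPower.map p f u : ExteriorAlgebra R M') = ExteriorAlgebra.map f u := by
  have h : (⋀[R]^p M').subtype ∘ₗ exteriorPower.map p f =
      (ExteriorAlgebra.map f).toLinearMap ∘ₗ (⋀[R]^p M).subtype := by
    refine exteriorPower.linearMap_ext ?_
    ext v
    simp [exteriorPower.ιMulti_apply_coe, ExteriorAlgebra.map_apply_ιMulti]
  exact LinearMap.congr_fun h u

/-- The exact sequence `⋀^p (M/s) → ⋀^{p+1} M → ⋀^{p+1} (M/s) → 0`, whose first map is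
multiplication by `s`, together with a bound on its kernel. -/
lemma exists_exterior_exact {π : M →ₗ[R] M'} (hπ : Function.Surjective π) {s : M}
    (hs : LinearMap.ker π = Submodule.span R {s}) (p : ℕ) :
    ∃ j : ⋀[R]^p M' →ₗ[R] ⋀[R]^(p + 1) M,
      Function.Exact j (exteriorPower.map (p + 1) π) ∧
      ∀ (φ : M →ₗ[R] R) (u : ⋀[R]^p M'), j u = 0 → φ s • u = 0 := by
  have hsur := exteriorPower.map_surjective (n := p) hπ
  have hπs : π s = 0 := by
    rw [← LinearMap.mem_ker, hs]
    exact Submodule.mem_span_singleton_self s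
  let w : ⋀[R]^p M →ₗ[R] ⋀[R]^(p + 1) M :=
    (LinearMap.mulLeft R (ι R s)).restrict fun u hu => by
      rw [exteriorPower, pow_succ']
      exact Submodule.mul_mem_mul (LinearMap.mem_range_self _ s) hu
  have hw : ∀ u, (w u : ExteriorAlgebra R M) = ι R s * u := fun u => rfl
  have hker : LinearMap.ker (exteriorPower.map p π) ≤ LinearMap.ker w := by
    intro u hu
    rw [LinearMap.mem_ker] at hu
    obtain ⟨v, hv⟩ := exists_eq_ι_mul_of_map_eq_zero hπ hs
      (by rw [← coe_exteriorPower_map, hu, Submodule.coe_zero])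
    rw [LinearMap.mem_ker, ← Subtype.coe_inj, hw, hv, ← mul_assoc, ι_sq_zero, zero_mul]
    rfl
  let j : ⋀[R]^p M' →ₗ[R] ⋀[R]^(p + 1) M :=
    (LinearMap.ker (exteriorPower.map p π)).liftQ w hker ∘ₗ
      ((exteriorPower.map p π).quotKerEquivOfSurjective hsur).symm.toLinearMap
  have hj : ∀ u, j (exteriorPower.map p π u) = w u := fun u => by
    have h : ((exteriorPower.map p π).quotKerEquivOfSurjective hsur).symm
        (exteriorPower.map p π u) = (LinearMap.ker (exteriorPower.map p π)).mkQ u := by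
      rw [LinearEquiv.symm_apply_eq]
      rfl
    change (LinearMap.ker (exteriorPower.map p π)).liftQ w hker
      (((exteriorPower.map p π).quotKerEquivOfSurjective hsur).symm _) = _
    rw [h]
    rfl
  refine ⟨j, fun y => ⟨fun hy => ?_, ?_⟩, fun φ u' hu' => ?_⟩
  · obtain ⟨v, hv⟩ := exists_eq_ι_mul_of_map_eq_zero hπ hs
      (by rw [← coe_exteriorPower_map, hy, Submodule.coe_zero])
    obtain ⟨v', hv', h⟩ := exists_mem_exteriorPower_eq_ι_mul (hv ▸ y.2)
    refine ⟨exteriorPower.map p π ⟨v', hv'⟩, ?_⟩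
    rw [hj, ← Subtype.coe_inj, hw, hv, h]
  · rintro ⟨u', rfl⟩
    obtain ⟨u, rfl⟩ := hsur u'
    rw [hj, ← Subtype.coe_inj, coe_exteriorPower_map, hw, map_mul, map_apply_ι, hπs, map_zero,
      zero_mul]
    rfl
  · obtain ⟨u, rfl⟩ := hsur u'
    rw [hj, ← Subtype.coe_inj, hw] at hu'
    have h := CliffordAlgebra.contractLeft_ι_mul (Q := (0 : QuadraticForm R M)) φ s
      (u : ExteriorAlgebra R M)
    have h0 : CliffordAlgebra.ι (0 : QuadraticForm R M) s * (u : ExteriorAlgebra R M) = 0 := hu'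
    rw [h0, map_zero, eq_comm, sub_eq_zero] at h
    rw [← Subtype.coe_inj, Submodule.coe_smul, coe_exteriorPower_map, ← map_smul]
    have h1 := congrArg (ExteriorAlgebra.map π) h
    rw [h1]
    refine (map_mul (ExteriorAlgebra.map π) (ι R s) _).trans ?_
    rw [map_apply_ι, hπs, map_zero, zero_mul]
    rfl

end ExteriorSequence

section ExteriorProjectiveDimension

variable {R : Type} [CommRing R]

/-- The isomorphism of exterior powers induced by an isomorphism of modules. -/
def exteriorPowerCongr (p : ℕ) {M N : Type} [AddCommGroup M] [Module R M] [AddCommGroup N]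
    [Module R N] (e : M ≃ₗ[R] N) : ⋀[R]^p M ≃ₗ[R] ⋀[R]^p N :=
  LinearEquiv.ofLinearMap (exteriorPower.map p e) (exteriorPower.map p e.symm)
    (by rw [← exteriorPower.map_comp, LinearEquiv.comp_symm, exteriorPower.map_id])
    (by rw [← exteriorPower.map_comp, LinearEquiv.symm_comp, exteriorPower.map_id])

lemma projective_exteriorPower (p : ℕ) (M : Type) [AddCommGroup M] [Module R M]
    [Module.Projective R M] : Module.Projective R (⋀[R]^p M) := by
  obtain ⟨s, hs⟩ := Module.projective_def'.1 (inferInstance : Module.Projective R M)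
  exact Module.Projective.of_split (exteriorPower.map p s)
    (exteriorPower.map p (Finsupp.linearCombination R (id : M → M)))
    (by rw [← exteriorPower.map_comp, hs, exteriorPower.map_id])

/-- The exterior powers `⋀^p M` have projective dimension at most `p` for `p ≤ n`, with equality
for `1 ≤ p` unless `M` is projective. -/
def ExteriorPd (R : Type) [CommRing R] (n : ℕ) (M : Type) [AddCommGroup M] [Module R M] : Prop :=
  (∀ p ≤ n, PdLE R p (⋀[R]^p M)) ∧
    (¬ Module.Projective R M → ∀ p < n, ¬ PdLE R p (⋀[R]^(p + 1) M))

lemma exteriorPd_of_projective (n : ℕ) (M : Type) [AddCommGroup M] [Module R M]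
    [h : Module.Projective R M] : ExteriorPd R n M :=
  ⟨fun p _ => (pdLE_zero_iff.2 (projective_exteriorPower p M)).mono p.zero_le, fun h' => (h' h).elim⟩

variable {M N : Type} [AddCommGroup M] [Module R M] [AddCommGroup N] [Module R N]

lemma ExteriorPd.of_equiv {n : ℕ} (h : ExteriorPd R n M) (e : M ≃ₗ[R] N) : ExteriorPd R n N :=
  ⟨fun p hp => (h.1 p hp).of_equiv (exteriorPowerCongr p e), fun hN p hp hp' =>
    h.2 (fun _ => hN (Module.Projective.of_equiv e)) p hp
      (hp'.of_equiv (exteriorPowerCongr (p + 1) e.symm))⟩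

lemma projective_of_pdLE_exteriorPower_one (h : PdLE R 0 (⋀[R]^1 M)) : Module.Projective R M :=
  pdLE_zero_iff.1 (h.of_equiv (exteriorPower.oneEquiv R M))

end ExteriorProjectiveDimension

section PolynomialExteriorPd

variable {M E : Type} [AddCommGroup M] [Module (PS K ℓ) M] [AddCommGroup E] [Module (PS K ℓ) E]

/-- Dividing out a single element on which the functionals of `M` take the values `awayPoly A m x`
preserves the estimates on the projective dimensions of exterior powers. -/
lemma ExteriorPd.quotient_singleton (A : Arrangement K ℓ) (m : (Fin ℓ → K) → ℕ)
    (hM : ExteriorPd (PS K ℓ) ℓ M) {π : M →ₗ[PS K ℓ] E} (hπ : Function.Surjective π) {s : M}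
    (hs : LinearMap.ker π = Submodule.span (PS K ℓ) {s})
    (hφ : ∀ x : Fin ℓ → K, x ≠ 0 → ∃ φ : M →ₗ[PS K ℓ] PS K ℓ, φ s = awayPoly A m x) :
    ExteriorPd (PS K ℓ) ℓ E := by
  choose j hj hjφ using exists_exterior_exact hπ hs
  have hsur : ∀ p, Function.Surjective (exteriorPower.map p π) :=
    fun p => exteriorPower.map_surjective hπ
  have hinj : ∀ p < ℓ, PdLE (PS K ℓ) p (⋀[PS K ℓ]^p E) → Function.Injective (j p) := by
    intro p hp h
    rw [injective_iff_map_eq_zero]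
    intro u hu
    refine h.eq_zero_of_awayPoly hp A m fun x hx => ?_
    obtain ⟨φ, hφ⟩ := hφ x hx
    exact ⟨1, by rw [pow_one, ← hφ, hjφ p φ u hu]⟩
  have hupper : ∀ p ≤ ℓ, PdLE (PS K ℓ) p (⋀[PS K ℓ]^p E) := by
    intro p
    induction p with
    | zero =>
      exact fun _ => (pdLE_zero_iff.2 inferInstance).of_equiv
        (exteriorPower.zeroEquiv (PS K ℓ) E).symm
    | succ p ih =>
      intro hp
      exact PdLE.right (hinj p (by omega) (ih (by omega))) (hj p) (hsur _) (ih (by omega))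
        (hM.1 _ hp)
  refine ⟨hupper, fun hE p hp h => ?_⟩
  by_cases hMp : Module.Projective (PS K ℓ) M
  · refine hE ?_
    induction p with
    | zero => exact projective_of_pdLE_exteriorPower_one h
    | succ p ih =>
      exact ih (by omega) (PdLE.left (hinj _ hp (hupper _ hp.le)) (hj _) (hsur _)
        ((pdLE_zero_iff.2 (projective_exteriorPower _ M)).mono p.zero_le) h)
  · exact hM.2 hMp p hp (PdLE.middle (hinj p hp (hupper p hp.le)) (hj p) (hsur _)
      (hupper p hp.le) h)

lemma ExteriorPd.quotient (A : Arrangement K ℓ) (m : (Fin ℓ → K) → ℕ) {b : ℕ}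
    (hM : ExteriorPd (PS K ℓ) ℓ M) {π : M →ₗ[PS K ℓ] E} (hπ : Function.Surjective π)
    {s : Fin b → M} (hs : LinearMap.ker π = Submodule.span (PS K ℓ) (Set.range s))
    (hφ : ∀ x : Fin ℓ → K, x ≠ 0 → ∃ φ : M →ₗ[PS K ℓ] (Fin b → PS K ℓ),
      ∀ j, φ (s j) = Pi.single j (awayPoly A m x)) :
    ExteriorPd (PS K ℓ) ℓ E := by
  induction b generalizing M with
  | zero =>
    refine hM.of_equiv (LinearEquiv.ofBijective π ⟨?_, hπ⟩)
    rw [← LinearMap.ker_eq_bot, hs, Set.range_eq_empty, Submodule.span_empty]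
  | succ b ih =>
    let N := Submodule.span (PS K ℓ) {s 0}
    have hN : N ≤ LinearMap.ker π := by
      rw [hs]
      exact Submodule.span_mono (Set.singleton_subset_iff.2 ⟨0, rfl⟩)
    have hM1 : ExteriorPd (PS K ℓ) ℓ (M ⧸ N) := by
      refine hM.quotient_singleton A m N.mkQ_surjective N.ker_mkQ fun x hx => ?_
      obtain ⟨φ, hφ⟩ := hφ x hx
      exact ⟨LinearMap.proj 0 ∘ₗ φ, by simp [hφ]⟩
    refine ih hM1 (π := N.liftQ π hN) (s := fun j => N.mkQ (s j.succ)) ?_ ?_ ?_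
    · intro y
      obtain ⟨z, rfl⟩ := hπ y
      exact ⟨N.mkQ z, rfl⟩
    · have h0 : N.mkQ (s 0) = 0 :=
        (Submodule.Quotient.mk_eq_zero N).2 (Submodule.mem_span_singleton_self _)
      rw [Submodule.ker_liftQ, hs, Submodule.map_span, ← Set.range_comp]
      refine le_antisymm (Submodule.span_le.2 ?_) (Submodule.span_mono ?_)
      · rintro _ ⟨i, rfl⟩
        refine Fin.cases ?_ (fun i => ?_) i
        · rw [Function.comp_apply, h0]
          exact zero_mem _
        · exact Submodule.subset_span ⟨i, rfl⟩
      · rintro _ ⟨i, rfl⟩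
        exact ⟨i.succ, rfl⟩
    · intro x hx
      obtain ⟨φ, hφ⟩ := hφ x hx
      refine ⟨N.liftQ (LinearMap.funLeft (PS K ℓ) (PS K ℓ) Fin.succ ∘ₗ φ) ?_, fun j => ?_⟩
      · rw [Submodule.span_singleton_le_iff_mem, LinearMap.mem_ker]
        ext i
        simp [hφ, LinearMap.funLeft_apply]
      · rw [Submodule.mkQ_apply, Submodule.liftQ_apply, LinearMap.comp_apply, hφ]
        ext i : 1
        simp [LinearMap.funLeft_apply, Pi.single_apply]

/-- The projective dimensions of the exterior powers of a finite module of projective dimension at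
most one which is a direct summand of a projective module up to each `awayPoly A m x`. -/
lemma exteriorPd_of_pdLE_one (A : Arrangement K ℓ) (m : (Fin ℓ → K) → ℕ)
    [Module.Finite (PS K ℓ) E] (hE : PdLE (PS K ℓ) 1 E)
    (hF : ∀ x : Fin ℓ → K, x ≠ 0 → ∃ (F : Type) (_ : AddCommGroup F) (_ : Module (PS K ℓ) F)
      (_ : Module.Projective (PS K ℓ) F) (g : E →ₗ[PS K ℓ] F) (h : F →ₗ[PS K ℓ] E),
      ∀ y, h (g y) = awayPoly A m x • y) :
    ExteriorPd (PS K ℓ) ℓ E := by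
  obtain ⟨n, f, hf⟩ := Module.Finite.exists_fin' (PS K ℓ) E
  let P := LinearMap.ker f
  have hP : Module.Projective (PS K ℓ) P := pdLE_zero_iff.1
    (PdLE.left (Submodule.subtype_injective _) (exact_subtype_ker f) hf
      (pdLE_zero_iff.2 inferInstance) hE)
  obtain ⟨k, r, hr⟩ := Module.Finite.exists_fin' (PS K ℓ) P
  obtain ⟨i, hi⟩ := Module.projective_lifting_property r LinearMap.id hr
  have hri : ∀ a, r (i a) = a := fun a => LinearMap.congr_fun hi a
  let Q := LinearMap.ker r
  let τ : (Fin k → PS K ℓ) →ₗ[PS K ℓ] Q :=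
    LinearMap.codRestrict Q (LinearMap.id - i ∘ₗ r) fun v => by simp [Q, hri]
  have hQ : Module.Projective (PS K ℓ) Q := by
    refine Module.Projective.of_split Q.subtype τ (LinearMap.ext fun v => Subtype.ext ?_)
    have hv : r v = 0 := v.2
    simp [τ, hv]
  let θ : (Fin k → PS K ℓ) →ₗ[PS K ℓ] (Fin n → PS K ℓ) × Q := (P.subtype ∘ₗ r).prod τ
  refine (exteriorPd_of_projective ℓ ((Fin n → PS K ℓ) × Q)).quotient A m
    (π := f ∘ₗ LinearMap.fst _ _ _) (s := fun j => θ (Pi.single j 1))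
    (hf.comp LinearMap.fst_surjective) ?_ fun x hx => ?_
  · have hrange : Submodule.span (PS K ℓ) (Set.range fun j => θ (Pi.single j 1)) =
        LinearMap.range θ := by
      rw [LinearMap.range_eq_map, ← (Pi.basisFun (PS K ℓ) (Fin k)).span_eq, Submodule.map_span,
        ← Set.range_comp]
      congr 2
      ext j : 1
      simp
    rw [hrange]
    refine le_antisymm (fun y hy => ?_) ?_
    · obtain ⟨a, q⟩ := y
      have hq : r q = 0 := q.2
      refine ⟨i ⟨a, hy⟩ + q, ?_⟩
      refine Prod.ext ?_ (Subtype.ext ?_)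
      · simp [θ, hri, hq]
      · simp [θ, τ, hri, hq]
    · rintro _ ⟨v, rfl⟩
      exact (r v).2
  · obtain ⟨F, _, _, _, g, h, hgh⟩ := hF x hx
    obtain ⟨h', hh'⟩ := Module.projective_lifting_property f h hf
    have hfh : ∀ y, f (h' (g y)) = awayPoly A m x • y := fun y =>
      (LinearMap.congr_fun hh' (g y)).trans (hgh y)
    let ψ : (Fin n → PS K ℓ) →ₗ[PS K ℓ] P :=
      LinearMap.codRestrict P (awayPoly A m x • LinearMap.id - h' ∘ₗ g ∘ₗ f) fun a => by
        simp [P, hfh]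
    refine ⟨(i ∘ₗ ψ).coprod (awayPoly A m x • Q.subtype), fun j => ?_⟩
    have hψ : ∀ a : P, ψ a = awayPoly A m x • a := fun a => by
      have ha : f a = 0 := a.2
      refine Subtype.ext ?_
      simp [ψ, ha]
    have : ∀ v, ((i ∘ₗ ψ).coprod (awayPoly A m x • Q.subtype)) (θ v) = awayPoly A m x • v := by
      intro v
      change i (ψ (r v : Fin n → PS K ℓ)) + awayPoly A m x • (v - i (r v)) = _
      rw [hψ, map_smul, ← smul_add, add_sub_cancel]
    rw [this, ← Pi.single_smul, smul_eq_mul, mul_one]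

end PolynomialExteriorPd

section LinearForms

lemma coeff_linP (c : Fin ℓ → K) (i : Fin ℓ) : (linP c).coeff (Finsupp.single i 1) = c i := by
  simp only [linP, MvPolynomial.coeff_sum, MvPolynomial.coeff_C_mul, MvPolynomial.coeff_X]
  rw [Finset.sum_eq_single i]
  · simp
  · intro j _ hj
    simp [Finsupp.single_left_inj, hj]
  · simp

lemma linP_ne_zero {c : Fin ℓ → K} (hc : c ≠ 0) : linP c ≠ 0 := fun h =>
  hc (funext fun i => by rw [← coeff_linP c i, h]; simp)

lemma totalDegree_linP {c : Fin ℓ → K} (hc : c ≠ 0) : (linP c).totalDegree = 1 :=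
  (MvPolynomial.IsHomogeneous.sum _ _ _ fun i _ =>
    MvPolynomial.isHomogeneous_C_mul_X (c i) i).totalDegree (linP_ne_zero hc)

lemma irreducible_linP {c : Fin ℓ → K} (hc : c ≠ 0) : Irreducible (linP c) := by
  refine MvPolynomial.irreducible_of_totalDegree_eq_one (totalDegree_linP hc) fun x hx => ?_
  obtain ⟨i, hi⟩ := Function.ne_iff.1 hc
  rw [isUnit_iff_ne_zero]
  rintro rfl
  exact hi (zero_dvd_iff.1 (coeff_linP c i ▸ hx (Finsupp.single i 1)))

lemma isRelPrime_linP {c c' : Fin ℓ → K} (hc : c ≠ 0) (hc' : c' ≠ 0)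
    (h : ∀ t : K, c' ≠ t • c) : IsRelPrime (linP c) (linP c') := by
  rw [(irreducible_linP hc).isRelPrime_iff_not_dvd]
  rintro ⟨a, ha⟩
  have ha0 : a ≠ 0 := by
    rintro rfl
    exact linP_ne_zero hc' (by rw [ha, mul_zero])
  have hdeg := MvPolynomial.totalDegree_mul_of_isDomain (linP_ne_zero hc) ha0
  rw [← ha, totalDegree_linP hc, totalDegree_linP hc'] at hdeg
  obtain ⟨t, rfl⟩ : ∃ t, a = MvPolynomial.C t :=
    ⟨_, MvPolynomial.totalDegree_eq_zero_iff_eq_C.1 (by omega)⟩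
  refine h t (funext fun i => ?_)
  rw [← coeff_linP c' i, ha, mul_comm, MvPolynomial.coeff_C_mul, coeff_linP, Pi.smul_apply,
    smul_eq_mul]

lemma Arrangement.isRelPrime_pow (A : Arrangement K ℓ) (m : (Fin ℓ → K) → ℕ) {c c' : Fin ℓ → K}
    (hc : c ∈ A.hyps) (hc' : c' ∈ A.hyps) (h : c' ≠ c) :
    IsRelPrime (linP c ^ m c) (linP c' ^ m c') :=
  (isRelPrime_linP (A.ne_zero c hc) (A.ne_zero c' hc') (A.nonprop c' hc' c hc h)).pow

/-- The product of the factors of `Qpoly A m` other than the one of `c`. -/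
def Qerase (A : Arrangement K ℓ) (m : (Fin ℓ → K) → ℕ) (c : Fin ℓ → K) : PS K ℓ :=
  ∏ c' ∈ A.hyps.erase c, linP c' ^ m c'

lemma mul_Qerase (A : Arrangement K ℓ) (m : (Fin ℓ → K) → ℕ) {c : Fin ℓ → K} (hc : c ∈ A.hyps) :
    linP c ^ m c * Qerase A m c = Qpoly A m :=
  Finset.mul_prod_erase _ _ hc

lemma isRelPrime_Qerase (A : Arrangement K ℓ) (m : (Fin ℓ → K) → ℕ) {c : Fin ℓ → K}
    (hc : c ∈ A.hyps) : IsRelPrime (linP c ^ m c) (Qerase A m c) :=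
  IsRelPrime.prod_right fun _ hc' => A.isRelPrime_pow m hc (Finset.mem_of_mem_erase hc')
    (Finset.ne_of_mem_erase hc')

lemma Qpoly_ne_zero (A : Arrangement K ℓ) (m : (Fin ℓ → K) → ℕ) : Qpoly A m ≠ 0 :=
  Finset.prod_ne_zero_iff.2 fun c hc => pow_ne_zero _ (linP_ne_zero (A.ne_zero c hc))

lemma awayPoly_mul_Qpoly_locArr (A : Arrangement K ℓ) (m : (Fin ℓ → K) → ℕ) (x : Fin ℓ → K) :
    awayPoly A m x * Qpoly (locArr A x) m = Qpoly A m :=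
  (mul_comm _ _).trans (Finset.prod_filter_mul_prod_filter_not _ _ _)

end LinearForms

section FreeDivisibility

variable {R M : Type} [CommRing R] [AddCommGroup M] [Module R M]

lemma exists_eq_smul_of_dvd_repr {I : Type} (b : Module.Basis I R M) {a : R} {w : M}
    (h : ∀ i, a ∣ b.repr w i) : ∃ w', w = a • w' := by
  choose f hf using h
  refine ⟨∑ i ∈ (b.repr w).support, f i • b i, ?_⟩
  conv_lhs => rw [← b.linearCombination_repr w, Finsupp.linearCombination_apply, Finsupp.sum]
  rw [Finset.smul_sum]
  exact Finset.sum_congr rfl fun i _ => by rw [hf i, mul_smul]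

lemma exists_eq_smul_of_isRelPrime [DecompositionMonoid R] [Module.Free R M] {a b : R}
    (hab : IsRelPrime a b) {w θ : M} (h : b • w = a • θ) : ∃ w', w = a • w' := by
  let B := Module.Free.chooseBasis R M
  refine exists_eq_smul_of_dvd_repr B fun i => hab.dvd_of_dvd_mul_left ⟨B.repr θ i, ?_⟩
  simpa using congrArg (fun z => B.repr z i) h

lemma exists_eq_Qpoly_smul {M : Type} [AddCommGroup M] [Module (PS K ℓ) M]
    [Module.Free (PS K ℓ) M] (A : Arrangement K ℓ) (m : (Fin ℓ → K) → ℕ) {w : M}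
    (h : ∀ c ∈ A.hyps, ∃ θ, w = linP c ^ m c • θ) : ∃ w', w = Qpoly A m • w' := by
  let B := Module.Free.chooseBasis (PS K ℓ) M
  refine exists_eq_smul_of_dvd_repr B fun i =>
    Finset.prod_dvd_of_isRelPrime (fun c hc c' hc' hcc' => A.isRelPrime_pow m hc hc' hcc'.symm)
      fun c hc => ?_
  obtain ⟨θ, hθ⟩ := h c hc
  exact ⟨B.repr θ i, by simpa using congrArg (fun z => B.repr z i) hθ⟩

end FreeDivisibility

section PolynomialForms

instance : Module.Free (PS K ℓ) (ExtF K ℓ) :=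
  Module.Free.of_basis (Pi.basisFun (PS K ℓ) (Fin ℓ)).ExteriorAlgebra

instance : Module.Finite (PS K ℓ) (ExtF K ℓ) :=
  Module.Finite.of_basis (Pi.basisFun (PS K ℓ) (Fin ℓ)).ExteriorAlgebra

/-- The `p`-form component of a polynomial form. -/
def formComp (p : ℕ) (η : ExtF K ℓ) : ExtF K ℓ :=
  DirectSum.decompose (fun i : ℕ => ⋀[PS K ℓ]^i (Fin ℓ → PS K ℓ)) η p

lemma formComp_mem (p : ℕ) (η : ExtF K ℓ) : formComp p η ∈ formsP K ℓ p := SetLike.coe_mem _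

lemma formComp_of_mem {p : ℕ} {η : ExtF K ℓ} (h : η ∈ formsP K ℓ p) : formComp p η = η :=
  DirectSum.decompose_of_mem_same (fun i : ℕ => ⋀[PS K ℓ]^i (Fin ℓ → PS K ℓ)) h

lemma formComp_smul (p : ℕ) (a : PS K ℓ) (η : ExtF K ℓ) :
    formComp p (a • η) = a • formComp p η := by
  rw [formComp, DirectSum.decompose_smul]
  rfl

lemma exists_mem_formsP_of_eq_smul {p : ℕ} {η ζ : ExtF K ℓ} {a : PS K ℓ}
    (hη : η ∈ formsP K ℓ p) (h : η = a • ζ) : ∃ ζ' ∈ formsP K ℓ p, η = a • ζ' :=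
  ⟨formComp p ζ, formComp_mem p ζ, by rw [← formComp_smul, ← h, formComp_of_mem hη]⟩

lemma mul_mem_formsP {p q : ℕ} {η ζ : ExtF K ℓ} (hη : η ∈ formsP K ℓ p)
    (hζ : ζ ∈ formsP K ℓ q) : η * ζ ∈ formsP K ℓ (p + q) := by
  rw [formsP, pow_add]
  exact Submodule.mul_mem_mul hη hζ

lemma ι_mem_formsP (v : Fin ℓ → PS K ℓ) : ExteriorAlgebra.ι (PS K ℓ) v ∈ formsP K ℓ 1 := by
  rw [formsP, pow_one]
  exact LinearMap.mem_range_self _ v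

lemma dP_mem_formsP (c : Fin ℓ → K) : dP c ∈ formsP K ℓ 1 := ι_mem_formsP _

lemma exists_eq_ι_of_mem_formsP {η : ExtF K ℓ} (h : η ∈ formsP K ℓ 1) :
    ∃ v, η = ExteriorAlgebra.ι (PS K ℓ) v := by
  rw [formsP, pow_one] at h
  obtain ⟨v, rfl⟩ := h
  exact ⟨v, rfl⟩

lemma dP_mul_ι (c : Fin ℓ → K) (v : Fin ℓ → PS K ℓ) :
    dP c * ExteriorAlgebra.ι (PS K ℓ) v = -(ExteriorAlgebra.ι (PS K ℓ) v * dP c) :=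
  eq_neg_of_add_eq_zero_left (ExteriorAlgebra.ι_add_mul_swap _ v)

lemma dP_mul_self (c : Fin ℓ → K) : dP c * dP c = 0 := ExteriorAlgebra.ι_sq_zero _

/-- A contraction of polynomial forms by a constant vector field `d` with `dα(d) = 1`. -/
lemma exists_contraction {c : Fin ℓ → K} (hc : c ≠ 0) :
    ∃ D : ExtF K ℓ →ₗ[PS K ℓ] ExtF K ℓ,
      (∀ ζ, ζ = dP c * D ζ + D (dP c * ζ)) ∧ (∀ a, D (algebraMap (PS K ℓ) _ a) = 0) ∧
      ∀ p, ∀ ζ ∈ formsP K ℓ (p + 1), D ζ ∈ formsP K ℓ p := by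
  obtain ⟨k, hk⟩ := Function.ne_iff.1 hc
  let d : Module.Dual (PS K ℓ) (Fin ℓ → PS K ℓ) :=
    (MvPolynomial.C (c k)⁻¹ : PS K ℓ) • LinearMap.proj (φ := fun _ : Fin ℓ => PS K ℓ) k
  have hd : d (fun i => MvPolynomial.C (c i)) = 1 := by
    simp only [d, LinearMap.smul_apply, LinearMap.proj_apply, smul_eq_mul]
    rw [← map_mul, inv_mul_cancel₀ hk, map_one]
  let D : ExtF K ℓ →ₗ[PS K ℓ] ExtF K ℓ :=
    CliffordAlgebra.contractLeft (Q := (0 : QuadraticForm (PS K ℓ) (Fin ℓ → PS K ℓ))) d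
  have hD : ∀ v ζ, D (ExteriorAlgebra.ι (PS K ℓ) v * ζ) =
      d v • ζ - ExteriorAlgebra.ι (PS K ℓ) v * D ζ :=
    fun v ζ => CliffordAlgebra.contractLeft_ι_mul d v ζ
  refine ⟨D, fun ζ => ?_, CliffordAlgebra.contractLeft_algebraMap _ d, fun p => ?_⟩
  · rw [dP, hD, hd, one_smul, add_sub_cancel]
  · induction p with
    | zero =>
      intro ζ hζ
      obtain ⟨v, rfl⟩ := exists_eq_ι_of_mem_formsP hζ
      have h : D (ExteriorAlgebra.ι (PS K ℓ) v) = algebraMap _ _ (d v) :=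
        CliffordAlgebra.contractLeft_ι _ d v
      rw [h, formsP, pow_zero]
      exact Submodule.algebraMap_mem _
    | succ p ih =>
      intro ζ hζ
      rw [formsP, pow_succ'] at hζ
      refine Submodule.mul_induction_on hζ ?_ fun x y hx hy => ?_
      · rintro _ ⟨v, rfl⟩ ζ hζ
        rw [hD]
        refine sub_mem (Submodule.smul_mem _ _ hζ) ?_
        rw [add_comm]
        exact mul_mem_formsP (ι_mem_formsP v) (ih ζ hζ)
      · rw [map_add]
        exact add_mem hx hy

end PolynomialForms

section WedgeMap

variable {R V : Type} [CommRing R] [AddCommGroup V] [Module R V]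

/-- The algebra map `⋀ N → ⋀ V` attached to a submodule `N` of the degree one part of `⋀ V`. -/
def wedgeHom (N : Submodule R (ExteriorAlgebra R V))
    (hN : N ≤ LinearMap.range (ExteriorAlgebra.ι R)) :
    ExteriorAlgebra R N →ₐ[R] ExteriorAlgebra R V :=
  ExteriorAlgebra.lift R ⟨N.subtype, fun n => by
    obtain ⟨v, hv⟩ := hN n.2
    rw [Submodule.subtype_apply, ← hv, ExteriorAlgebra.ι_sq_zero]⟩

variable {N : Submodule R (ExteriorAlgebra R V)} (hN : N ≤ LinearMap.range (ExteriorAlgebra.ι R))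

lemma map_wedgeHom_exteriorPower (p : ℕ) :
    (⋀[R]^p N).map (wedgeHom N hN).toLinearMap = N ^ p := by
  rw [ExteriorAlgebra.exteriorPower, Submodule.map_pow, ← LinearMap.range_comp]
  congr 1
  have h : (wedgeHom N hN).toLinearMap ∘ₗ ExteriorAlgebra.ι R = N.subtype :=
    LinearMap.ext fun n => ExteriorAlgebra.lift_ι_apply _ _ _ n
  rw [h, Submodule.range_subtype]

lemma exteriorPower_map_smul_id (M : Type) [AddCommGroup M] [Module R M] (p : ℕ) (a : R)
    (u : ⋀[R]^p M) : exteriorPower.map p (a • (LinearMap.id : M →ₗ[R] M)) u = a ^ p • u := by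
  have h : exteriorPower.map p (a • (LinearMap.id : M →ₗ[R] M)) = a ^ p • LinearMap.id := by
    refine exteriorPower.linearMap_ext ?_
    ext v : 1
    simpa using (exteriorPower.ιMulti R p).toMultilinearMap.map_smul_univ (fun _ => a) v
  rw [h]
  rfl

lemma pow_smul_eq_zero_of_wedgeHom_eq_zero {a : R} (ha : ∀ v : V, a • ExteriorAlgebra.ι R v ∈ N)
    {p : ℕ} {u : ⋀[R]^p N} (hu : wedgeHom N hN u = 0) : a ^ p • u = 0 := by
  let h : V →ₗ[R] N := LinearMap.codRestrict N (a • ExteriorAlgebra.ι R) ha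
  have hcomp : (ExteriorAlgebra.map h).comp (wedgeHom N hN) =
      ExteriorAlgebra.map (a • (LinearMap.id : N →ₗ[R] N)) := by
    refine ExteriorAlgebra.hom_ext (LinearMap.ext fun n => ?_)
    obtain ⟨v, hv⟩ := hN n.2
    have h1 : wedgeHom N hN (ExteriorAlgebra.ι R n) = ExteriorAlgebra.ι R v :=
      (ExteriorAlgebra.lift_ι_apply _ _ _ n).trans hv.symm
    have h2 : h v = a • n := Subtype.ext (congrArg (a • ·) hv)
    change ExteriorAlgebra.map h (wedgeHom N hN (ExteriorAlgebra.ι R n)) =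
      ExteriorAlgebra.map (a • (LinearMap.id : N →ₗ[R] N)) (ExteriorAlgebra.ι R n)
    rw [h1, ExteriorAlgebra.map_apply_ι, ExteriorAlgebra.map_apply_ι, h2]
    rfl
  rw [← exteriorPower_map_smul_id, ← Subtype.coe_inj, coe_exteriorPower_map, ← hcomp]
  change ExteriorAlgebra.map h (wedgeHom N hN u) = _
  rw [hu, map_zero]
  rfl

/-- The exterior power `⋀^p N` is isomorphic to the `p`-th power of `N` inside `⋀ V` when it is
torsion-free. -/
lemma nonempty_exteriorPower_equiv_pow [IsDomain R] (N : Submodule R (ExteriorAlgebra R V))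
    (hN : N ≤ LinearMap.range (ExteriorAlgebra.ι R)) {a : R} (ha0 : a ≠ 0)
    (ha : ∀ v : V, a • ExteriorAlgebra.ι R v ∈ N) {p : ℕ}
    (htf : ∀ b : R, b ≠ 0 → ∀ u : ⋀[R]^p N, b • u = 0 → u = 0) :
    Nonempty (⋀[R]^p N ≃ₗ[R] (N ^ p : Submodule R (ExteriorAlgebra R V))) := by
  let f : ⋀[R]^p N →ₗ[R] ExteriorAlgebra R V :=
    (wedgeHom N hN).toLinearMap ∘ₗ (⋀[R]^p N).subtype
  have hf : Function.Injective f := by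
    rw [injective_iff_map_eq_zero]
    exact fun u hu => htf _ (pow_ne_zero p ha0) u (pow_smul_eq_zero_of_wedgeHom_eq_zero hN ha hu)
  have hrange : LinearMap.range f = N ^ p := by
    rw [LinearMap.range_comp, Submodule.range_subtype, map_wedgeHom_exteriorPower]
  exact ⟨(LinearEquiv.ofInjective f hf).trans (LinearEquiv.ofEq _ _ hrange)⟩

end WedgeMap

section LogarithmicForms

variable {A : Arrangement K ℓ} {m : (Fin ℓ → K) → ℕ}

lemma mem_Omega_iff {p : ℕ} {ζ : ExtF K ℓ} : ζ ∈ Omega A m p ↔ ζ ∈ formsP K ℓ p ∧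
    ∀ c ∈ A.hyps, ∃ ξ ∈ formsP K ℓ (p + 1), dP c * ζ = linP c ^ m c • ξ := by
  simp [Omega, Submodule.mem_iInf, eq_comm]

lemma mem_Omega_of {p : ℕ} {ζ : ExtF K ℓ} (hζ : ζ ∈ formsP K ℓ p)
    (h : ∀ c ∈ A.hyps, ∃ ξ, dP c * ζ = linP c ^ m c • ξ) : ζ ∈ Omega A m p :=
  mem_Omega_iff.2 ⟨hζ, fun c hc => by
    obtain ⟨ξ, hξ⟩ := h c hc
    refine exists_mem_formsP_of_eq_smul ?_ hξ
    rw [add_comm]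
    exact mul_mem_formsP (dP_mem_formsP c) hζ⟩

lemma Omega_le_formsP (p : ℕ) : Omega A m p ≤ formsP K ℓ p := inf_le_left

lemma Qpoly_smul_mem_Omega {p : ℕ} {ζ : ExtF K ℓ} (hζ : ζ ∈ formsP K ℓ p) :
    Qpoly A m • ζ ∈ Omega A m p :=
  mem_Omega_of (Submodule.smul_mem _ _ hζ) fun c hc =>
    ⟨Qerase A m c • (dP c * ζ), by rw [smul_smul, mul_Qerase A m hc, mul_smul_comm]⟩

lemma Qerase_smul_dP_mem_Omega (c : Fin ℓ → K) :
    Qerase A m c • dP c ∈ Omega A m 1 := by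
  refine mem_Omega_of (Submodule.smul_mem _ _ (dP_mem_formsP c)) fun c' hc' => ?_
  by_cases h : c' = c
  · exact ⟨0, by rw [h, mul_smul_comm, dP_mul_self, smul_zero, smul_zero]⟩
  · obtain ⟨a, ha⟩ : linP c' ^ m c' ∣ Qerase A m c :=
      Finset.dvd_prod_of_mem (fun c => linP c ^ m c) (Finset.mem_erase.2 ⟨h, hc'⟩)
    exact ⟨a • (dP c' * dP c), by rw [smul_smul, ← ha, mul_smul_comm]⟩

/-- Along each hyperplane a logarithmic one-form is a combination of `dα` and a multiple of
`α ^ m`. -/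
lemma exists_eq_of_mem_Omega_one {η : ExtF K ℓ} (hη : η ∈ Omega A m 1) {c : Fin ℓ → K}
    (hc : c ∈ A.hyps) : ∃ (f : PS K ℓ) (v : Fin ℓ → PS K ℓ),
      η = f • dP c + linP c ^ m c • ExteriorAlgebra.ι (PS K ℓ) v := by
  obtain ⟨D, hD, -, hDp⟩ := exists_contraction (A.ne_zero c hc)
  obtain ⟨h1, h2⟩ := mem_Omega_iff.1 hη
  obtain ⟨ξ, hξ, hη'⟩ := h2 c hc
  obtain ⟨v, hv⟩ := exists_eq_ι_of_mem_formsP (hDp 1 ξ hξ)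
  have h0 := hDp 0 η h1
  rw [formsP, pow_zero, Submodule.mem_one] at h0
  obtain ⟨f, hf⟩ := h0
  refine ⟨f, v, ?_⟩
  conv_lhs => rw [hD η, hη', map_smul, hv, ← hf, ← Algebra.commutes, ← Algebra.smul_def]

lemma exists_mul_eq_Qpoly_smul {p : ℕ} {η ζ : ExtF K ℓ} (hη : η ∈ Omega A m 1)
    (hζ : ζ ∈ Omega A m p) : ∃ ζ' ∈ Omega A m (p + 1), η * ζ = Qpoly A m • ζ' := by
  obtain ⟨hζp, hζA⟩ := mem_Omega_iff.1 hζ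
  have hmem : η * ζ ∈ formsP K ℓ (p + 1) := by
    rw [add_comm]
    exact mul_mem_formsP (Omega_le_formsP 1 hη) hζp
  have hdiv : ∀ c ∈ A.hyps, ∃ θ, η * ζ = linP c ^ m c • θ := fun c hc => by
    obtain ⟨f, v, rfl⟩ := exists_eq_of_mem_Omega_one hη hc
    obtain ⟨ξ, -, hξ⟩ := hζA c hc
    refine ⟨f • ξ + ExteriorAlgebra.ι (PS K ℓ) v * ζ, ?_⟩
    rw [add_mul, smul_mul_assoc, hξ, smul_mul_assoc, smul_add, smul_comm]
  obtain ⟨ζ'', h''⟩ := exists_eq_Qpoly_smul A m hdiv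
  obtain ⟨ζ', hζ', h⟩ := exists_mem_formsP_of_eq_smul hmem h''
  refine ⟨ζ', mem_Omega_of hζ' fun c hc => ?_, h⟩
  obtain ⟨f, v, hη'⟩ := exists_eq_of_mem_Omega_one hη hc
  obtain ⟨ξ, -, hξ⟩ := hζA c hc
  refine exists_eq_smul_of_isRelPrime (isRelPrime_Qerase A m hc)
    (θ := -(ExteriorAlgebra.ι (PS K ℓ) v * ξ)) ?_
  refine smul_right_injective _ (pow_ne_zero (m c) (linP_ne_zero (A.ne_zero c hc))) ?_
  change linP c ^ m c • Qerase A m c • (dP c * ζ') = linP c ^ m c • linP c ^ m c • _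
  rw [smul_smul, mul_Qerase A m hc, ← mul_smul_comm, ← h, hη', add_mul, mul_add, smul_mul_assoc,
    mul_smul_comm, ← mul_assoc, dP_mul_self, zero_mul, smul_zero, zero_add, smul_mul_assoc,
    mul_smul_comm, ← mul_assoc, dP_mul_ι, neg_mul, mul_assoc, hξ, mul_smul_comm]
  simp only [smul_neg]

lemma Omega_one_pow_le (p : ℕ) : Omega A m 1 ^ (p + 1) ≤
    Submodule.map (LinearMap.lsmul (PS K ℓ) (ExtF K ℓ) (Qpoly A m ^ p)) (Omega A m (p + 1)) := by
  induction p with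
  | zero =>
    intro η hη
    rw [zero_add, pow_one] at hη
    exact ⟨η, hη, by simp⟩
  | succ p ih =>
    rw [pow_succ', Submodule.mul_le]
    intro η hη ζ hζ
    obtain ⟨ζ, hζ', rfl⟩ := ih hζ
    obtain ⟨ζ', h, h'⟩ := exists_mul_eq_Qpoly_smul hη hζ'
    exact ⟨ζ', h, by simp [pow_succ, mul_smul, h']⟩

lemma pow_smul_mem_pow {R B : Type} [CommRing R] [Ring B] [Algebra R B] {N N' : Submodule R B}
    {a : R} (h : ∀ y ∈ N, a • y ∈ N') (p : ℕ) {y : B} (hy : y ∈ N ^ p) : a ^ p • y ∈ N' ^ p := by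
  induction p generalizing y with
  | zero => simpa using hy
  | succ p ih =>
    rw [pow_succ] at hy
    refine Submodule.mul_induction_on hy (fun x hx z hz => ?_) fun x z hx hz => ?_
    · rw [pow_succ, pow_succ, ← smul_mul_smul_comm]
      exact Submodule.mul_mem_mul (ih hx) (h z hz)
    · rw [smul_add]
      exact add_mem hx hz

lemma Omega_one_le_range : Omega A m 1 ≤ LinearMap.range (ExteriorAlgebra.ι (PS K ℓ)) :=
  fun η hη => by
    obtain ⟨v, rfl⟩ := exists_eq_ι_of_mem_formsP (Omega_le_formsP 1 hη)
    exact LinearMap.mem_range_self _ v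

lemma Qpoly_pow_smul_mem_pow {p : ℕ} {ζ : ExtF K ℓ} (hζ : ζ ∈ formsP K ℓ p) :
    Qpoly A m ^ p • ζ ∈ Omega A m 1 ^ p := by
  refine pow_smul_mem_pow (fun y hy => ?_) p hζ
  obtain ⟨v, rfl⟩ := hy
  exact Qpoly_smul_mem_Omega (ι_mem_formsP v)

lemma FreeM.free_pow (h : FreeM A m) (p : ℕ) :
    Module.Free (PS K ℓ) (Omega A m 1 ^ p : Submodule (PS K ℓ) (ExtF K ℓ)) := by
  have : Module.Free (PS K ℓ) (Omega A m 1) := h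
  obtain ⟨e⟩ := nonempty_exteriorPower_equiv_pow (Omega A m 1) Omega_one_le_range
    (Qpoly_ne_zero A m) (fun v => Qpoly_smul_mem_Omega (ι_mem_formsP v)) (p := p)
    fun b hb u hu => (smul_eq_zero_iff_right hb).1 hu
  exact Module.Free.of_equiv e

lemma FreeM.Qpoly_pow_smul_mem (h : FreeM A m) {p : ℕ} {ζ : ExtF K ℓ}
    (hζ : ζ ∈ Omega A m (p + 1)) : Qpoly A m ^ p • ζ ∈ Omega A m 1 ^ (p + 1) := by
  have hfree := h.free_pow (p + 1)
  obtain ⟨hζp, hζA⟩ := mem_Omega_iff.1 hζ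
  have hQ : Qpoly A m • Qpoly A m ^ p • ζ ∈ Omega A m 1 ^ (p + 1) := by
    rw [smul_smul, ← pow_succ']
    exact Qpoly_pow_smul_mem_pow hζp
  have herase : ∀ c ∈ A.hyps, Qerase A m c • Qpoly A m ^ p • ζ ∈ Omega A m 1 ^ (p + 1) := by
    intro c hc
    obtain ⟨D, hD, -, hDp⟩ := exists_contraction (A.ne_zero c hc)
    obtain ⟨ξ, hξ, hζξ⟩ := hζA c hc
    have h1 : Qerase A m c • Qpoly A m ^ p • ζ =
        (Qerase A m c • dP c) * (Qpoly A m ^ p • D ζ) + Qpoly A m ^ (p + 1) • D ξ := by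
      conv_lhs => rw [hD ζ, hζξ]
      rw [map_smul, smul_add, smul_add, smul_mul_smul_comm, smul_smul, smul_smul, smul_smul,
        pow_succ, ← mul_Qerase A m hc]
      congr 2
      ring
    rw [h1]
    refine add_mem ?_ (Qpoly_pow_smul_mem_pow (hDp _ ξ hξ))
    rw [pow_succ']
    exact Submodule.mul_mem_mul (Qerase_smul_dP_mem_Omega c) (Qpoly_pow_smul_mem_pow (hDp _ ζ hζp))
  obtain ⟨w, hw⟩ := exists_eq_Qpoly_smul A m
    (w := (⟨_, hQ⟩ : (Omega A m 1 ^ (p + 1) : Submodule (PS K ℓ) (ExtF K ℓ))))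
    fun c hc => ⟨⟨_, herase c hc⟩, Subtype.ext (by
      rw [Submodule.coe_smul, smul_smul (linP c ^ m c), mul_Qerase A m hc])⟩
  have hw' : Qpoly A m ^ p • ζ = w :=
    smul_right_injective _ (Qpoly_ne_zero A m) (congrArg Subtype.val hw)
  rw [hw']
  exact w.2

lemma Omega_le_locArr (x : Fin ℓ → K) (p : ℕ) : Omega A m p ≤ Omega (locArr A x) m p :=
  fun _ hζ => mem_Omega_iff.2 ⟨(mem_Omega_iff.1 hζ).1, fun c hc =>
    (mem_Omega_iff.1 hζ).2 c (Finset.mem_filter.1 hc).1⟩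

lemma awayPoly_smul_mem {x : Fin ℓ → K} {p : ℕ} {ζ : ExtF K ℓ}
    (hζ : ζ ∈ Omega (locArr A x) m p) : awayPoly A m x • ζ ∈ Omega A m p := by
  obtain ⟨hζp, hζA⟩ := mem_Omega_iff.1 hζ
  refine mem_Omega_of (Submodule.smul_mem _ _ hζp) fun c hc => ?_
  by_cases h : ∑ i, c i * x i = 0
  · obtain ⟨ξ, -, hξ⟩ := hζA c (Finset.mem_filter.2 ⟨hc, h⟩)
    exact ⟨awayPoly A m x • ξ, by rw [mul_smul_comm, hξ, smul_comm]⟩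
  · obtain ⟨a, ha⟩ : linP c ^ m c ∣ awayPoly A m x :=
      Finset.dvd_prod_of_mem (fun c => linP c ^ m c) (Finset.mem_filter.2 ⟨hc, h⟩)
    exact ⟨a • (dP c * ζ), by rw [smul_smul, ← ha, mul_smul_comm]⟩

end LogarithmicForms

section LocallyFree

variable {A : Arrangement K ℓ} {m : (Fin ℓ → K) → ℕ}

/-- The inclusion of `Ω^p(A, m)` into `Ω^p(A_x, m_x)`. -/
def toLoc (A : Arrangement K ℓ) (m : (Fin ℓ → K) → ℕ) (x : Fin ℓ → K) (p : ℕ) :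
    Omega A m p →ₗ[PS K ℓ] Omega (locArr A x) m p :=
  Submodule.inclusion (Omega_le_locArr x p)

/-- Multiplication by `awayPoly A m x` as a map from `Ω^p(A_x, m_x)` to `Ω^p(A, m)`. -/
def ofLoc (A : Arrangement K ℓ) (m : (Fin ℓ → K) → ℕ) (x : Fin ℓ → K) (p : ℕ) :
    Omega (locArr A x) m p →ₗ[PS K ℓ] Omega A m p :=
  LinearMap.codRestrict _ (awayPoly A m x • (Omega (locArr A x) m p).subtype) fun ζ =>
    awayPoly_smul_mem ζ.2

lemma ofLoc_toLoc (x : Fin ℓ → K) (p : ℕ) (ζ : Omega A m p) :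
    ofLoc A m x p (toLoc A m x p ζ) = awayPoly A m x • ζ := by
  refine Subtype.ext ?_
  rw [ofLoc, LinearMap.codRestrict_apply, LinearMap.smul_apply, toLoc, Submodule.subtype_apply,
    Submodule.coe_inclusion, Submodule.coe_smul]

lemma exteriorPd_Omega_one (hlf : ∀ x : Fin ℓ → K, x ≠ 0 → FreeM (locArr A x) m)
    (h1 : PdLE (PS K ℓ) 1 (Omega A m 1)) : ExteriorPd (PS K ℓ) ℓ (Omega A m 1) :=
  exteriorPd_of_pdLE_one A m h1 fun x hx =>
    have : Module.Free (PS K ℓ) (Omega (locArr A x) m 1) := hlf x hx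
    ⟨_, _, _, inferInstance, toLoc A m x 1, ofLoc A m x 1,
      ofLoc_toLoc x 1⟩

/-- Torsion of `⋀^p M` is killed by `a ^ p` if multiplication by `a` on `M` factors through a free
module. -/
lemma pow_smul_eq_zero_of_factor_free {R M F : Type} [CommRing R] [IsDomain R] [AddCommGroup M]
    [Module R M] [AddCommGroup F] [Module R F] [Module.Free R F] {a b : R} (g : M →ₗ[R] F)
    (h : F →ₗ[R] M) (hgh : ∀ y, h (g y) = a • y) (hb : b ≠ 0) {p : ℕ} {u : ⋀[R]^p M}
    (hu : b • u = 0) : a ^ p • u = 0 := by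
  have hgh' : h ∘ₗ g = a • LinearMap.id := LinearMap.ext hgh
  have h0 : exteriorPower.map p g u = 0 :=
    (smul_eq_zero_iff_right hb).1 (by rw [← map_smul, hu, map_zero])
  rw [← exteriorPower_map_smul_id, ← hgh', exteriorPower.map_comp, LinearMap.comp_apply, h0,
    map_zero]

lemma nonempty_exteriorPower_equiv_Omega_one_pow
    (hlf : ∀ x : Fin ℓ → K, x ≠ 0 → FreeM (locArr A x) m) {p n : ℕ}
    (hpd : PdLE (PS K ℓ) n (⋀[PS K ℓ]^p (Omega A m 1))) (hn : n < ℓ) :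
    Nonempty (⋀[PS K ℓ]^p (Omega A m 1) ≃ₗ[PS K ℓ]
      (Omega A m 1 ^ p : Submodule (PS K ℓ) (ExtF K ℓ))) := by
  have htf : ∀ b : PS K ℓ, b ≠ 0 → ∀ u : ⋀[PS K ℓ]^p (Omega A m 1), b • u = 0 → u = 0 := by
    refine fun b hb u hu => hpd.eq_zero_of_awayPoly hn A m fun x hx => ⟨p, ?_⟩
    have : Module.Free (PS K ℓ) (Omega (locArr A x) m 1) := hlf x hx
    exact pow_smul_eq_zero_of_factor_free (toLoc A m x 1) (ofLoc A m x 1) (ofLoc_toLoc x 1) hb hu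
  exact nonempty_exteriorPower_equiv_pow (Omega A m 1) Omega_one_le_range (Qpoly_ne_zero A m)
    (fun v => Qpoly_smul_mem_Omega (ι_mem_formsP v)) htf

lemma Omega_one_pow_eq (hlf : ∀ x : Fin ℓ → K, x ≠ 0 → FreeM (locArr A x) m) {p n : ℕ}
    (hpd : PdLE (PS K ℓ) n (Omega A m 1 ^ (p + 1) : Submodule (PS K ℓ) (ExtF K ℓ)))
    (hn : n + 2 ≤ ℓ) : Omega A m 1 ^ (p + 1) =
      Submodule.map (LinearMap.lsmul (PS K ℓ) (ExtF K ℓ) (Qpoly A m ^ p)) (Omega A m (p + 1)) := by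
  refine le_antisymm (Omega_one_pow_le p) ?_
  rintro _ ⟨ζ, hζ, rfl⟩
  refine hpd.mem_of_awayPoly hn A m fun x hx => ⟨p + 1, ?_⟩
  have h := pow_smul_mem_pow (N' := Omega A m 1) (fun y hy => awayPoly_smul_mem hy) (p + 1)
    ((hlf x hx).Qpoly_pow_smul_mem (Omega_le_locArr x _ hζ))
  rw [LinearMap.lsmul_apply, ← awayPoly_mul_Qpoly_locArr A m x, mul_pow, mul_smul, smul_comm]
  exact Submodule.smul_mem _ _ h

lemma pdLE_Omega_zero : PdLE (PS K ℓ) 0 (Omega A m 0) := by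
  have hmem : ∀ a : PS K ℓ, algebraMap (PS K ℓ) (ExtF K ℓ) a ∈ formsP K ℓ 0 := fun a => by
    rw [formsP, pow_zero]
    exact Submodule.algebraMap_mem a
  let f : PS K ℓ →ₗ[PS K ℓ] Omega A m 0 :=
    LinearMap.codRestrict _ (Qpoly A m • Algebra.linearMap (PS K ℓ) (ExtF K ℓ)) fun a =>
      Qpoly_smul_mem_Omega (hmem a)
  refine PdLE.of_equiv (M := PS K ℓ) (pdLE_zero_iff.2 inferInstance)
    (LinearEquiv.ofBijective f ⟨?_, ?_⟩)
  · intro a b hab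
    have h : Qpoly A m • algebraMap (PS K ℓ) (ExtF K ℓ) a = Qpoly A m • algebraMap _ _ b :=
      congrArg Subtype.val hab
    exact ExteriorAlgebra.algebraMap_leftInverse _ |>.injective
      (smul_right_injective _ (Qpoly_ne_zero A m) h)
  · rintro ⟨ζ, hζ⟩
    obtain ⟨h0, hA⟩ := mem_Omega_iff.1 hζ
    obtain ⟨w, hw⟩ : ∃ w, ζ = Qpoly A m • w := by
      refine exists_eq_Qpoly_smul A m fun c hc => ?_
      obtain ⟨D, hD, hD0, -⟩ := exists_contraction (A.ne_zero c hc)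
      obtain ⟨ξ, -, h⟩ := hA c hc
      have h0' := h0
      rw [formsP, pow_zero, Submodule.mem_one] at h0'
      obtain ⟨a, rfl⟩ := h0'
      refine ⟨D ξ, ?_⟩
      rw [← map_smul, ← h, ← zero_add (D _), ← mul_zero (dP c), ← hD0 a]
      exact hD _
    obtain ⟨w', hw', h⟩ := exists_mem_formsP_of_eq_smul h0 hw
    rw [formsP, pow_zero, Submodule.mem_one] at hw'
    obtain ⟨a, rfl⟩ := hw'
    exact ⟨a, Subtype.ext h.symm⟩

lemma nonempty_Omega_equiv_exteriorPower
    (hlf : ∀ x : Fin ℓ → K, x ≠ 0 → FreeM (locArr A x) m)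
    (h1 : PdLE (PS K ℓ) 1 (Omega A m 1)) {p : ℕ} (hp : p + 3 ≤ ℓ) :
    Omega A m 1 ^ (p + 1) =
      Submodule.map (LinearMap.lsmul (PS K ℓ) (ExtF K ℓ) (Qpoly A m ^ p)) (Omega A m (p + 1)) ∧
    Nonempty (Omega A m (p + 1) ≃ₗ[PS K ℓ] ⋀[PS K ℓ]^(p + 1) (Omega A m 1)) := by
  have hpd := (exteriorPd_Omega_one hlf h1).1 (p + 1) (by omega)
  obtain ⟨e⟩ := nonempty_exteriorPower_equiv_Omega_one_pow hlf hpd (by omega)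
  have heq := Omega_one_pow_eq hlf (hpd.of_equiv e) (by omega)
  have hinj : Function.Injective (LinearMap.lsmul (PS K ℓ) (ExtF K ℓ) (Qpoly A m ^ p)) :=
    smul_right_injective _ (pow_ne_zero p (Qpoly_ne_zero A m))
  exact ⟨heq, ⟨((Submodule.equivMapOfInjective _ hinj _).trans
    (LinearEquiv.ofEq _ _ heq.symm)).trans e.symm⟩⟩

end LocallyFree

/-- **Musta\c{t}\u{a}–Schenck theorem for multiarrangements.**  If `(A, m)` is locally
free and `pd_S Ω^1(A,m) = 1`, then `⋀^p Ω^1(A,m) = Ω^p(A,m)` and `pd_S Ω^p(A,m) = p`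
for all `0 ≤ p ≤ ℓ - 2`; in particular `(A, m)` is tame.  (In the polynomial model
`Q(A,m)·Ω^•(A,m)`, the equality `⋀^p Ω^1(A,m) = Ω^p(A,m)` reads
`(Q·Ω^1)^p = Q^{p-1}·(Q·Ω^p)`.) -/
theorem mustata_schenck_multi
    {K : Type} [Field K] {ℓ : ℕ} (A : Arrangement K ℓ) (hess : Essential A)
    (m : (Fin ℓ → K) → ℕ) (hm : ∀ c ∈ A.hyps, 0 < m c)
    (hlf : ∀ x : Fin ℓ → K, x ≠ 0 → FreeM (locArr A x) m)
    (hpd1 : pdim (PS K ℓ) (Omega A m 1) = 1) :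
    (∀ p : ℕ, 1 ≤ p → p ≤ ℓ - 2 →
      (Omega A m 1) ^ p =
        Submodule.map (LinearMap.lsmul (PS K ℓ) (ExtF K ℓ) (Qpoly A m ^ (p - 1)))
          (Omega A m p)) ∧
    (∀ p : ℕ, p ≤ ℓ - 2 → pdim (PS K ℓ) (Omega A m p) = (p : ℕ∞)) ∧
    TameM A m := by
  obtain ⟨h1, h0⟩ := (pdim_eq_iff 1 (Omega A m 1)).1 (by exact_mod_cast hpd1)
  have hnp : ¬ Module.Projective (PS K ℓ) (Omega A m 1) := fun h =>
    h0 0 one_pos (pdLE_zero_iff.2 h)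
  have hG := exteriorPd_Omega_one hlf h1
  have hpd : ∀ p : ℕ, p ≤ ℓ - 2 → pdim (PS K ℓ) (Omega A m p) = (p : ℕ∞) := by
    intro p hp
    rw [pdim_eq_iff]
    rcases p with _ | p
    · exact ⟨pdLE_Omega_zero, fun k hk => absurd hk k.not_lt_zero⟩
    · obtain ⟨-, ⟨e⟩⟩ := nonempty_Omega_equiv_exteriorPower hlf h1 (p := p) (by omega)
      exact ⟨(hG.1 (p + 1) (by omega)).of_equiv e.symm, fun k hk h =>
        hG.2 hnp p (by omega) ((h.of_equiv e).mono (by omega))⟩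
  refine ⟨fun p hp1 hp => ?_, hpd, fun p hp => ?_⟩
  · obtain ⟨p, rfl⟩ := Nat.exists_eq_add_of_le' hp1
    exact (nonempty_Omega_equiv_exteriorPower hlf h1 (by omega)).1
  · rw [pdLE_iff_PdLE]
    rcases le_or_gt p (ℓ - 2) with h | h
    · exact ((pdim_eq_iff p _).1 (hpd p h)).1
    rcases hp.eq_or_lt with rfl | h'
    · exact pdLE_mvPolynomial _ _
    obtain rfl : ℓ = p + 1 := by omega
    exact pdLE_submodule _
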